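/- arXiv:2202.01596 — 7 statements merged into one kernel-verified Lean document; each statement's English description precedes it below -/
import Mathlib

section
/- Let α and β be irrational badly approximable real numbers. For n ∈ ℕ let q_n(α) denote the denominator of the n-th convergent of the regular continued fraction expansion of α, and likewise q_n(β). Suppose there exist a sequence (η_n)_{n≥1} of real numbers with 0 ≤ η_n < 1/3 for every n and an index n₀ such that for all n ≥ n₀: (1) q_{2n}(β)^{11/12 + η_n/4} ≤ q_{2n}(α) ≤ q_{2n}(β), and (2) lcm(q_{2n}(α), q_{2n}(β)) ≤ q_{2n}(β)^{1 + η_n}. Then liminf_{n→∞} n·‖nα‖·‖nβ‖ = 0, i.e. the pair (α, β) satisfies the Littlewood conjecture. -/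
open Filter

/-- Integer data of two families of fractions `p i / (d i * a i)` and `r i / (d i * b i)`:
the cross determinants within each family are nonzero and bounded by `K`, and `a i`, `b i`, `d i`
have the orders of magnitude `h`, `h` and at least `h ^ 2`. -/
structure BalancedFractions {ι : Type*} (K h : ℤ) (a b d p r : ι → ℤ) : Prop where
  coprime : ∀ i, IsCoprime (a i) (b i)
  le_left : ∀ i, h ≤ K * a i
  left_le : ∀ i, a i ≤ K * h
  le_right : ∀ i, h ≤ K * b i
  right_le : ∀ i, b i ≤ K * h
  sq_le : ∀ i, h ^ 2 ≤ K * d i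
  det_left_ne : ∀ i j, i ≠ j → p i * (d j * a j) - p j * (d i * a i) ≠ 0
  det_left_le : ∀ i j, |p i * (d j * a j) - p j * (d i * a i)| ≤ K
  det_right_ne : ∀ i j, i ≠ j → r i * (d j * b j) - r j * (d i * b i) ≠ 0
  det_right_le : ∀ i j, |r i * (d j * b j) - r j * (d i * b i)| ≤ K

theorem abs_mul_le_of_le {x y A B : ℤ} (hx : |x| ≤ A) (hy : |y| ≤ B) : |x * y| ≤ A * B := by
  rw [abs_mul]
  exact mul_le_mul hx hy (abs_nonneg y) ((abs_nonneg x).trans hx)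

theorem eq_zero_of_dvd_of_abs_le {K h n z : ℤ} (hK : 1 ≤ K) (hh : 8 * K ^ 24 < h)
    (hn : h ≤ K * n) (hdvd : n ∣ z) (hz : |z| ≤ 8 * K ^ 23) : z = 0 := by
  refine Int.eq_zero_of_abs_lt_dvd hdvd ?_
  refine lt_of_mul_lt_mul_left (a := K) ?_ (by lia)
  calc K * |z| ≤ K * (8 * K ^ 23) := by gcongr
    _ = 8 * K ^ 24 := by ring
    _ < h := hh
    _ ≤ K * n := hn

/-- For three fractions with denominators `di * ai`, `dj * aj`, `dk * ak`, and three with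
denominators `di * bi`, `dj * bj`, `dk * bk`, the common factor `dk` divides a combination of
`ai * bj` and `aj * bi` with coefficients given by cross determinants. -/
theorem dvd_combination_of_dets (ai aj ak bi bj bk di dj dk pi pj pk ri rj rk : ℤ) :
    dk ∣ (pk * (di * ai) - pi * (dk * ak)) * (pj * (dk * ak) - pk * (dj * aj)) *
      ((pj * (dk * ak) - pk * (dj * aj)) * (rk * (di * bi) - ri * (dk * bk)) * (ai * bj) -
        (pk * (di * ai) - pi * (dk * ak)) * (rj * (dk * bk) - rk * (dj * bj)) * (aj * bi)) := by
  set Z := (pj * (dk * ak) - pk * (dj * aj)) * (rk * (di * bi) - ri * (dk * bk)) * (ai * bj) -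
        (pk * (di * ai) - pi * (dk * ak)) * (rj * (dk * bk) - rk * (dj * bj)) * (aj * bi) with hZ
  have h1 : dk ∣ di * (dj * Z) := by
    rw [hZ]
    refine ⟨ak * (pi * (dj * aj) - pj * (di * ai)) * (rj * (dk * bk) - rk * (dj * bj)) * (di * bi) +
      bk * (ri * (dj * bj) - rj * (di * bi)) * (pk * (di * ai) - pi * (dk * ak)) * (dj * aj) +
      ak * (pi * (dj * aj) - pj * (di * ai)) * (ri * (dj * bj) - rj * (di * bi)) * (dk * bk), ?_⟩
    ring
  obtain ⟨c, hc⟩ := h1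
  refine ⟨-(pk ^ 2 * ai * aj * c) + pk * ai * pj * ak * di * Z + pi * ak * pk * dj * aj * Z
    - pi * ak * pj * dk * ak * Z, ?_⟩
  linear_combination (-(pk ^ 2 * ai * aj)) * hc

theorem BalancedFractions.exists_relation {ι : Type*} {K h : ℤ} {a b d p r : ι → ℤ}
    (H : BalancedFractions K h a b d p r) (hK : 1 ≤ K) (hh : 8 * K ^ 24 < h) {i j k : ι}
    (hij : i ≠ j) (hjk : j ≠ k) (hki : k ≠ i) :
    ∃ A B e : ℤ, e ≠ 0 ∧ B ≠ 0 ∧ |A| ≤ K ^ 4 ∧ |B| ≤ K ^ 4 ∧ |e| ≤ 2 * K ^ 7 ∧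
      e * d k = A * (a i * b j) + B * (a j * b i) := by
  have hpos : 0 < h := lt_trans (by positivity) hh
  have hKpos : 0 < K := by lia
  have ha : ∀ i, 0 < a i := fun i =>
    pos_of_mul_pos_right (hpos.trans_le (H.le_left i)) hKpos.le
  have hb : ∀ i, 0 < b i := fun i =>
    pos_of_mul_pos_right (hpos.trans_le (H.le_right i)) hKpos.le
  have hd : ∀ i, 0 < d i := fun i =>
    pos_of_mul_pos_right ((by positivity : 0 < h ^ 2).trans_le (H.sq_le i)) hKpos.le
  obtain ⟨e, he⟩ := dvd_combination_of_dets (a i) (a j) (a k) (b i) (b j) (b k) (d i) (d j) (d k)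
    (p i) (p j) (p k) (r i) (r j) (r k)
  have x1 := H.det_left_ne k i hki
  have x2 := H.det_left_ne j k hjk
  have y1 := H.det_right_ne k i hki
  have y2 := H.det_right_ne j k hjk
  have x1' := H.det_left_le k i
  have x2' := H.det_left_le j k
  have y1' := H.det_right_le k i
  have y2' := H.det_right_le j k
  have x3 := H.det_left_ne i j hij
  have x3' := H.det_left_le i j
  set X1 := p k * (d i * a i) - p i * (d k * a k)
  set X2 := p j * (d k * a k) - p k * (d j * a j)
  set Y1 := r k * (d i * b i) - r i * (d k * b k)
  set Y2 := r j * (d k * b k) - r k * (d j * b j)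
  set X3 := p i * (d j * a j) - p j * (d i * a i) with hX3
  set A := X1 * X2 * (X2 * Y1) with hA
  set B := -(X1 * X2 * (X1 * Y2)) with hB
  have hB0 : B ≠ 0 := neg_ne_zero.mpr (by positivity)
  have hAle : |A| ≤ K ^ 4 := by
    calc |A| ≤ K * K * (K * K) :=
          abs_mul_le_of_le (abs_mul_le_of_le x1' x2') (abs_mul_le_of_le x2' y1')
      _ = K ^ 4 := by ring
  have hBle : |B| ≤ K ^ 4 := by
    rw [hB, abs_neg]
    calc _ ≤ K * K * (K * K) :=
          abs_mul_le_of_le (abs_mul_le_of_le x1' x2') (abs_mul_le_of_le x1' y2')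
      _ = K ^ 4 := by ring
  have hrel : e * d k = A * (a i * b j) + B * (a j * b i) := by
    rw [hA, hB]; linear_combination -he
  have habs : ∀ i j, |a i * b j| ≤ K * h * (K * h) := fun i j =>
    abs_mul_le_of_le (by rw [abs_of_pos (ha i)]; exact H.left_le i)
      (by rw [abs_of_pos (hb j)]; exact H.right_le j)
  refine ⟨A, B, e, ?_, hB0, hAle, hBle, ?_, hrel⟩
  · rintro rfl
    have h1 : a i ∣ B * a j := by
      refine (H.coprime i).dvd_of_dvd_mul_right (z := b i) ⟨-(A * b j), ?_⟩
      linear_combination -hrel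
    have h2 : a i ∣ B * X3 := by
      have : B * X3 = p i * d j * (B * a j) - a i * (B * p j * d i) := by rw [hX3]; ring
      rw [this]
      exact dvd_sub (h1.mul_left _) (dvd_mul_right _ _)
    refine mul_ne_zero hB0 x3 (eq_zero_of_dvd_of_abs_le hK hh (H.le_left i) h2 ?_)
    calc |B * X3| ≤ K ^ 4 * K := abs_mul_le_of_le hBle x3'
      _ = 1 * K ^ 5 := by ring
      _ ≤ 8 * K ^ 23 := by gcongr <;> norm_num
  · refine le_of_mul_le_mul_right ?_ (hd k)
    calc |e| * d k = |e * d k| := by rw [abs_mul, abs_of_pos (hd k)]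
      _ ≤ |A * (a i * b j)| + |B * (a j * b i)| := by rw [hrel]; exact abs_add_le _ _
      _ ≤ K ^ 4 * (K * h * (K * h)) + K ^ 4 * (K * h * (K * h)) :=
          add_le_add (abs_mul_le_of_le hAle (habs i j)) (abs_mul_le_of_le hBle (habs j i))
      _ = 2 * K ^ 6 * h ^ 2 := by ring
      _ ≤ 2 * K ^ 6 * (K * d k) := by gcongr; exact H.sq_le k
      _ = 2 * K ^ 7 * d k := by ring

theorem BalancedFractions.le_bound {K h : ℤ} {a b d p r : Fin 5 → ℤ}
    (H : BalancedFractions K h a b d p r) (hK : 1 ≤ K) : h ≤ 8 * K ^ 24 := by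
  by_contra! hh
  have hpos : 0 < h := lt_trans (by positivity) hh
  have hKpos : 0 < K := by lia
  have ha : 0 < a 0 := pos_of_mul_pos_right (hpos.trans_le (H.le_left 0)) hKpos.le
  have hd : ∀ i, h ≤ K * d i := fun i => by nlinarith [H.sq_le i]
  obtain ⟨A₂, B₂, e₂, he₂, hB₂, hA₂', hB₂', he₂', hr₂⟩ :=
    H.exists_relation hK hh (i := 0) (j := 1) (k := 2) (by decide) (by decide) (by decide)
  obtain ⟨A₃, B₃, e₃, he₃, hB₃, hA₃', hB₃', he₃', hr₃⟩ :=
    H.exists_relation hK hh (i := 0) (j := 1) (k := 3) (by decide) (by decide) (by decide)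
  obtain ⟨C₂, D₂, f₂, hf₂, hD₂, hC₂', hD₂', hf₂', hs₂⟩ :=
    H.exists_relation hK hh (i := 0) (j := 4) (k := 2) (by decide) (by decide) (by decide)
  obtain ⟨C₃, D₃, f₃, hf₃, hD₃, hC₃', hD₃', hf₃', hs₃⟩ :=
    H.exists_relation hK hh (i := 0) (j := 4) (k := 3) (by decide) (by decide) (by decide)
  -- Both `a 0 * b 1` and `a 0 * b 4` are, up to bounded factors, combinations of `d 2` and `d 3`.
  set S := B₃ * A₂ - B₂ * A₃
  set T := D₃ * C₂ - D₂ * C₃ with hT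
  have h1 : B₃ * e₂ * d 2 - B₂ * e₃ * d 3 = S * (a 0 * b 1) := by
    linear_combination B₃ * hr₂ - B₂ * hr₃
  have h2 : D₃ * f₂ * d 2 - D₂ * f₃ * d 3 = T * (a 0 * b 4) := by
    linear_combination D₃ * hs₂ - D₂ * hs₃
  have hTle : |T| ≤ 2 * K ^ 8 := by
    calc |T| ≤ |D₃ * C₂| + |D₂ * C₃| := abs_sub _ _
      _ ≤ K ^ 4 * K ^ 4 + K ^ 4 * K ^ 4 :=
        add_le_add (abs_mul_le_of_le hD₃' hC₂') (abs_mul_le_of_le hD₂' hC₃')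
      _ = 2 * K ^ 8 := by ring
  have hT0 : T ≠ 0 := by
    intro h0
    rw [h0] at h2
    have hdvd : d 2 ∣ D₂ * f₃ * (p 2 * (d 3 * a 3) - p 3 * (d 2 * a 2)) :=
      ⟨D₃ * f₂ * p 2 * a 3 - D₂ * f₃ * p 3 * a 2, by linear_combination -(p 2 * a 3) * h2⟩
    refine mul_ne_zero (mul_ne_zero hD₂ hf₃) (H.det_left_ne 2 3 (by decide))
      (eq_zero_of_dvd_of_abs_le hK hh (hd 2) hdvd ?_)
    calc _ ≤ K ^ 4 * (2 * K ^ 7) * K :=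
          abs_mul_le_of_le (abs_mul_le_of_le hD₂' hf₃') (H.det_left_le 2 3)
      _ = 2 * K ^ 12 := by ring
      _ ≤ 8 * K ^ 23 := by gcongr <;> norm_num
  -- Reducing modulo `a 0` shows that the two combinations are proportional.
  have hw : D₃ * f₂ * (B₂ * e₃) - B₃ * e₂ * (D₂ * f₃) = 0 := by
    set w := D₃ * f₂ * (B₂ * e₃) - B₃ * e₂ * (D₂ * f₃) with hwdef
    have hw2 : w * d 2 = a 0 * (B₂ * e₃ * (T * b 4) - D₂ * f₃ * (S * b 1)) := by
      rw [hwdef]; linear_combination B₂ * e₃ * h2 - D₂ * f₃ * h1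
    have hdvd : a 0 ∣ w * (p 0 * (d 2 * a 2) - p 2 * (d 0 * a 0)) :=
      ⟨p 0 * a 2 * (B₂ * e₃ * (T * b 4) - D₂ * f₃ * (S * b 1)) - w * p 2 * d 0, by
        linear_combination p 0 * a 2 * hw2⟩
    have hwle : |w| ≤ 8 * K ^ 22 := by
      calc |w| ≤ |D₃ * f₂ * (B₂ * e₃)| + |B₃ * e₂ * (D₂ * f₃)| := abs_sub _ _
        _ ≤ K ^ 4 * (2 * K ^ 7) * (K ^ 4 * (2 * K ^ 7)) +
            K ^ 4 * (2 * K ^ 7) * (K ^ 4 * (2 * K ^ 7)) :=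
          add_le_add
            (abs_mul_le_of_le (abs_mul_le_of_le hD₃' hf₂') (abs_mul_le_of_le hB₂' he₃'))
            (abs_mul_le_of_le (abs_mul_le_of_le hB₃' he₂') (abs_mul_le_of_le hD₂' hf₃'))
        _ = 8 * K ^ 22 := by ring
    refine (mul_eq_zero.mp (eq_zero_of_dvd_of_abs_le hK hh (H.le_left 0) hdvd ?_)).resolve_right
      (H.det_left_ne 0 2 (by decide))
    calc _ ≤ 8 * K ^ 22 * K := abs_mul_le_of_le hwle (H.det_left_le 0 2)
      _ = 8 * K ^ 23 := by ring
  -- Hence `b 1` and `b 4` have a bounded ratio, against their small common divisor.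
  have hb14 : D₃ * f₂ * S * b 1 = B₃ * e₂ * T * b 4 := by
    refine mul_left_cancel₀ ha.ne' ?_
    linear_combination B₃ * e₂ * h2 - D₃ * f₂ * h1 - d 3 * hw
  have hdvd : b 1 ∣ B₃ * e₂ * T * (r 1 * (d 4 * b 4) - r 4 * (d 1 * b 1)) :=
    ⟨r 1 * d 4 * (D₃ * f₂ * S) - B₃ * e₂ * T * r 4 * d 1, by
      linear_combination -(r 1 * d 4) * hb14⟩
  refine mul_ne_zero (mul_ne_zero (mul_ne_zero hB₃ he₂) hT0) (H.det_right_ne 1 4 (by decide))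
    (eq_zero_of_dvd_of_abs_le hK hh (H.le_right 1) hdvd ?_)
  calc _ ≤ K ^ 4 * (2 * K ^ 7) * (2 * K ^ 8) * K :=
        abs_mul_le_of_le (abs_mul_le_of_le (abs_mul_le_of_le hB₃' he₂') hTle)
          (H.det_right_le 1 4)
    _ = 4 * K ^ 20 := by ring
    _ ≤ 8 * K ^ 23 := by gcongr <;> norm_num

theorem Irrational.not_terminatedAt_genContFract {α : ℝ} (hα : Irrational α) (n : ℕ) :
    ¬(GenContFract.of α).TerminatedAt n := fun h => by
  obtain ⟨q, hq⟩ := (GenContFract.terminates_iff_rat α).mp ⟨n, h⟩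
  exact hα ⟨q, hq.symm⟩

theorem Irrational.exists_int_partDen {α : ℝ} (hα : Irrational α) (n : ℕ) :
    ∃ z : ℤ, 1 ≤ z ∧ (GenContFract.of α).s.get? n = some ⟨1, (z : ℝ)⟩ := by
  obtain ⟨⟨a, b⟩, hgp⟩ := Option.ne_none_iff_exists'.mp (hα.not_terminatedAt_genContFract n)
  obtain ⟨h1, z, hz⟩ := GenContFract.of_partNum_eq_one_and_exists_int_partDen_eq hgp
  have hb := GenContFract.of_one_le_get?_partDen (GenContFract.partDen_eq_s_b hgp)
  simp only at h1 hz hb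
  subst h1 hz
  exact ⟨z, by exact_mod_cast hb, hgp⟩

/-- The convergents of an irrational number as integer sequences. -/
theorem Irrational.exists_convergents {α : ℝ} (hα : Irrational α) :
    ∃ (p : ℕ → ℤ) (q : ℕ → ℕ), (∀ n, (q n : ℝ) = (GenContFract.of α).dens n) ∧ (∀ n, 0 < q n) ∧
      (∀ n, q n ≤ q (n + 1)) ∧ (∀ n, q n < q (n + 2)) ∧
      (∀ n, IsCoprime (p n) (q n)) ∧ ∀ n, |q n * α - p n| ≤ 1 / q (n + 1) := by
  have hnum : ∀ n, (∃ z : ℤ, (z : ℝ) = (GenContFract.of α).nums n) ∧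
      ∃ z : ℤ, (z : ℝ) = (GenContFract.of α).nums (n + 1) := by
    intro n
    induction n with
    | zero =>
      obtain ⟨z, -, hz⟩ := hα.exists_int_partDen 0
      refine ⟨⟨⌊α⌋, by simp⟩, ⟨z * ⌊α⌋ + 1, ?_⟩⟩
      rw [GenContFract.first_num_eq hz]
      simp
    | succ n ih =>
      obtain ⟨z, -, hz⟩ := hα.exists_int_partDen (n + 1)
      obtain ⟨⟨u, hu⟩, v, hv⟩ := ih
      refine ⟨⟨v, hv⟩, z * v + u, ?_⟩
      rw [GenContFract.nums_recurrence hz rfl rfl, ← hu, ← hv]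
      simp
  have hden : ∀ n, (∃ z : ℕ, 0 < z ∧ (z : ℝ) = (GenContFract.of α).dens n) ∧
      ∃ z : ℕ, 0 < z ∧ (z : ℝ) = (GenContFract.of α).dens (n + 1) := by
    intro n
    induction n with
    | zero =>
      obtain ⟨z, hz1, hz⟩ := hα.exists_int_partDen 0
      lift z to ℕ using by lia
      refine ⟨⟨1, one_pos, by simp⟩, z, by lia, ?_⟩
      rw [GenContFract.first_den_eq hz]
      simp
    | succ n ih =>
      obtain ⟨z, hz1, hz⟩ := hα.exists_int_partDen (n + 1)
      lift z to ℕ using by lia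
      obtain ⟨⟨u, hu0, hu⟩, v, hv0, hv⟩ := ih
      refine ⟨⟨v, hv0, hv⟩, z * v + u, by lia, ?_⟩
      rw [GenContFract.dens_recurrence hz rfl rfl, ← hu, ← hv]
      simp
  choose p hp using fun n => (hnum n).1
  choose q hq0 hq using fun n => (hden n).1
  have hmono : ∀ n, q n ≤ q (n + 1) := fun n => by
    have := GenContFract.of_den_mono (v := α) (n := n)
    rw [← hq, ← hq] at this
    exact_mod_cast this
  refine ⟨p, q, hq, hq0, hmono, fun n => ?_, fun n => ?_, fun n => ?_⟩
  · obtain ⟨z, hz1, hz⟩ := hα.exists_int_partDen (n + 1)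
    have h := GenContFract.dens_recurrence hz rfl rfl
    rw [← hq, ← hq, ← hq] at h
    have h' : (q (n + 2) : ℤ) = z * q (n + 1) + q n := by
      simp only [one_mul] at h
      exact_mod_cast h
    have := hq0 (n + 1)
    zify at this ⊢
    nlinarith
  · have h := SimpContFract.determinant (s := SimpContFract.of α)
      (hα.not_terminatedAt_genContFract n)
    change (GenContFract.of α).nums n * (GenContFract.of α).dens (n + 1) -
      (GenContFract.of α).dens n * (GenContFract.of α).nums (n + 1) = _ at h
    rw [← hp, ← hp, ← hq, ← hq] at h
    have h' : p n * q (n + 1) - q n * p (n + 1) = (-1) ^ (n + 1) := by exact_mod_cast h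
    refine ⟨(-1) ^ (n + 1) * q (n + 1), -((-1) ^ (n + 1) * p (n + 1)), ?_⟩
    have hs : ((-1 : ℤ) ^ (n + 1)) * (-1) ^ (n + 1) = 1 := by
      rw [← mul_pow]; simp
    linear_combination (-1) ^ (n + 1) * h' + hs
  · have h := GenContFract.abs_sub_convs_le (hα.not_terminatedAt_genContFract n)
    rw [GenContFract.conv_eq_num_div_den, ← hp, ← hq, ← hq] at h
    have h0 : (0 : ℝ) < q n := by exact_mod_cast hq0 n
    have h1 : (0 : ℝ) < q (n + 1) := by exact_mod_cast hq0 (n + 1)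
    calc |q n * α - p n| = q n * |α - p n / q n| := by
          rw [← abs_of_pos h0, ← abs_mul, abs_of_pos h0, mul_sub, mul_div_cancel₀ _ h0.ne']
      _ ≤ q n * (1 / (q n * q (n + 1))) := by gcongr
      _ = 1 / q (n + 1) := by field_simp

/-- The even convergents of a badly approximable number. -/
theorem Irrational.exists_even_convergents {α : ℝ} (hα : Irrational α)
    (hbad : ∃ C > (0 : ℝ), ∀ q : ℕ, 0 < q →
      C ≤ (q : ℝ) * |(q : ℝ) * α - round ((q : ℝ) * α)|) :
    ∃ (p : ℕ → ℤ) (q : ℕ → ℕ) (R : ℝ), 1 ≤ R ∧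
      (∀ n, (q n : ℝ) = (GenContFract.of α).dens (2 * n)) ∧ (∀ n, 0 < q n) ∧ StrictMono q ∧
      (∀ n, (q (n + 1) : ℝ) ≤ R * q n) ∧
      (∀ i j, i ≠ j → p i * q j - p j * q i ≠ 0) ∧
      ∀ n, |q n * α - p n| ≤ 1 / q n := by
  obtain ⟨p, q, hq, hq0, hmono, hlt, hcop, happ⟩ := hα.exists_convergents
  obtain ⟨C, hC, hbad⟩ := hbad
  have hq0' : ∀ n, (0 : ℝ) < q n := fun n => by exact_mod_cast hq0 n
  have hratio : ∀ n, (q (n + 1) : ℝ) ≤ C⁻¹ * q n := fun n => by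
    have h : C ≤ q n * (1 / q (n + 1)) :=
      (hbad _ (hq0 n)).trans
        (mul_le_mul_of_nonneg_left ((round_le _ (p n)).trans (happ n)) (hq0' n).le)
    rw [mul_one_div, le_div_iff₀ (hq0' _)] at h
    rw [inv_mul_eq_div, le_div_iff₀ hC]
    linarith
  have hCle : 1 ≤ C⁻¹ := by
    have h1 : (q 0 : ℝ) ≤ q 1 := by exact_mod_cast hmono 0
    exact le_of_mul_le_mul_right (by linarith [hratio 0]) (hq0' 0)
  have hstrict : StrictMono fun n => q (2 * n) := strictMono_nat_of_lt_succ fun n => hlt (2 * n)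
  refine ⟨fun n => p (2 * n), fun n => q (2 * n), C⁻¹ * C⁻¹,
    one_le_mul_of_one_le_of_one_le hCle hCle,
    fun n => hq _, fun n => hq0 _, hstrict, fun n => ?_, fun i j hij h => hij ?_, fun n => ?_⟩
  · calc (q (2 * n + 1 + 1) : ℝ) ≤ C⁻¹ * q (2 * n + 1) := hratio _
      _ ≤ C⁻¹ * (C⁻¹ * q (2 * n)) := by gcongr; exact hratio _
      _ = C⁻¹ * C⁻¹ * q (2 * n) := by ring
  · have h1 : (q (2 * i) : ℤ) ∣ q (2 * j) :=
      (hcop (2 * i)).symm.dvd_of_dvd_mul_left ⟨p (2 * j), by linear_combination h⟩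
    have h2 : (q (2 * j) : ℤ) ∣ q (2 * i) :=
      (hcop (2 * j)).symm.dvd_of_dvd_mul_left ⟨p (2 * i), by linear_combination -h⟩
    exact hstrict.injective (Nat.dvd_antisymm (by exact_mod_cast h1) (by exact_mod_cast h2))
  · refine (happ (2 * n)).trans (one_div_le_one_div_of_le (hq0' _) ?_)
    exact_mod_cast hmono (2 * n)

/-- Cross determinants of rational approximations with comparable denominators are bounded. -/
theorem abs_det_le_of_approx {α S : ℝ} {p p' : ℤ} {q q' : ℕ} (hq : 0 < q) (hq' : 0 < q')
    (h : |q * α - p| ≤ 1 / q) (h' : |q' * α - p'| ≤ 1 / q') (hqq : (q : ℝ) ≤ S * q')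
    (hqq' : (q' : ℝ) ≤ S * q) : ((|p * q' - p' * q| : ℤ) : ℝ) ≤ 2 * S := by
  have h0 : (0 : ℝ) < q := by exact_mod_cast hq
  have h0' : (0 : ℝ) < q' := by exact_mod_cast hq'
  push_cast
  calc |(p : ℝ) * q' - p' * q| = |q * (q' * α - p') - q' * (q * α - p)| := by ring_nf
    _ ≤ |q * (q' * α - p')| + |q' * (q * α - p)| := abs_sub _ _
    _ = q * |q' * α - p'| + q' * |q * α - p| := by
      rw [abs_mul, abs_mul, abs_of_pos h0, abs_of_pos h0']
    _ ≤ q * (1 / q') + q' * (1 / q) := by gcongr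
    _ ≤ S + S := by
      rw [mul_one_div, mul_one_div]
      exact add_le_add ((div_le_iff₀ h0').mpr hqq) ((div_le_iff₀ h0).mpr hqq')
    _ = 2 * S := by ring

/-- The growth conditions on `d * a` and `d * b`, together with `ε * d ≤ a * b`, force
`a`, `b` and the square root of `d` to be comparable. -/
theorem comparable_of_growth {a b d ε η : ℝ} (ha : 0 < a) (hb : 0 < b) (hd : 0 < d)
    (hε : 0 < ε) (hη : η < 1 / 3) (hdb : 1 ≤ d * b)
    (hlow : (d * b) ^ ((11 : ℝ) / 12 + η / 4) ≤ d * a) (hup : d * a ≤ d * b)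
    (hlcm : d * a * b ≤ (d * b) ^ (1 + η)) (hab : ε * d ≤ a * b) :
    a ≤ b ∧ ε * b ≤ a ∧ ε ^ 3 * b ^ 2 ≤ d ∧ ε * d ≤ b ^ 2 := by
  have hab' : a ≤ b := le_of_mul_le_mul_left hup hd
  set Q := d * b with hQ
  have hQ0 : 0 < Q := by positivity
  set s := Q ^ (-((1 / 3 - η) / 4)) with hs
  have hs0 : 0 < s := Real.rpow_pos_of_pos hQ0 _
  have hs1 : s ≤ 1 := Real.rpow_le_one_of_one_le_of_nonpos hdb (by linarith)
  have e1 : Q ^ ((11 : ℝ) / 12 + η / 4) = Q * s := by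
    rw [hs]
    nth_rewrite 2 [← Real.rpow_one Q]
    rw [← Real.rpow_add hQ0]
    congr 1
    ring
  have e2 : (Q ^ (1 + η)) ^ 3 = Q ^ 4 * s ^ 12 := by
    rw [hs, ← Real.rpow_natCast, ← Real.rpow_natCast, ← Real.rpow_natCast, ← Real.rpow_mul hQ0.le,
      ← Real.rpow_mul hQ0.le, ← Real.rpow_add hQ0]
    congr 1
    push_cast
    ring
  rw [e1] at hlow
  have hL : (d * a * b) ^ 3 ≤ Q ^ 4 * s ^ 12 := by
    rw [← e2]
    gcongr
  have hP : ε * ((d * a) ^ 2 * Q ^ 2) ≤ (d * a * b) ^ 3 := by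
    calc ε * ((d * a) ^ 2 * Q ^ 2) = (ε * d) * (d ^ 3 * a ^ 2 * b ^ 2) := by rw [hQ]; ring
      _ ≤ (a * b) * (d ^ 3 * a ^ 2 * b ^ 2) := by gcongr
      _ = (d * a * b) ^ 3 := by ring
  have hεs : ε ≤ s ^ 10 := by
    have h1 : ε * ((Q * s) ^ 2 * Q ^ 2) ≤ Q ^ 4 * s ^ 12 :=
      (by gcongr : ε * ((Q * s) ^ 2 * Q ^ 2) ≤ ε * ((d * a) ^ 2 * Q ^ 2)).trans (hP.trans hL)
    refine le_of_mul_le_mul_right ?_ (by positivity : 0 < Q ^ 4 * s ^ 2)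
    linarith [h1]
  have hεs' : ε ≤ s := hεs.trans (pow_le_of_le_one hs0.le hs1 (by norm_num))
  have hba : ε * b ≤ a := by
    refine le_of_mul_le_mul_left ?_ hd
    calc d * (ε * b) = Q * ε := by rw [hQ]; ring
      _ ≤ Q * s := by gcongr
      _ ≤ d * a := hlow
  have hdb2 : a ^ 3 ≤ d * b := by
    have h1 : (d * a * b) ^ 3 ≤ Q ^ 4 :=
      hL.trans (mul_le_of_le_one_right (by positivity) (pow_le_one₀ hs0.le hs1))
    refine le_of_mul_le_mul_left ?_ (by positivity : 0 < d ^ 3 * b ^ 3)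
    calc d ^ 3 * b ^ 3 * a ^ 3 = (d * a * b) ^ 3 := by ring
      _ ≤ Q ^ 4 := h1
      _ = d ^ 3 * b ^ 3 * (d * b) := by rw [hQ]; ring
  refine ⟨hab', hba, ?_, ?_⟩
  · refine le_of_mul_le_mul_right ?_ hb
    calc ε ^ 3 * b ^ 2 * b = (ε * b) ^ 3 := by ring
      _ ≤ a ^ 3 := by gcongr
      _ ≤ d * b := hdb2
  · calc ε * d ≤ a * b := hab
      _ ≤ b * b := by gcongr
      _ = b ^ 2 := by ring

/-- Bound for `n * ‖n * α‖ * ‖n * β‖` at the least common multiple `n = d * a * b` of two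
denominators `d * a` and `d * b`. -/
theorem mul_abs_mul_abs_le_of_common_factor {α β : ℝ} {a b d : ℕ} {p r : ℤ}
    (ha : 0 < a) (hb : 0 < b) (hd : 0 < d)
    (hα : |((d * a : ℕ) : ℝ) * α - p| ≤ 1 / (d * a : ℕ))
    (hβ : |((d * b : ℕ) : ℝ) * β - r| ≤ 1 / (d * b : ℕ)) :
    ((d * a * b : ℕ) : ℝ) *
      |((d * a * b : ℕ) : ℝ) * α - round (((d * a * b : ℕ) : ℝ) * α)| *
      |((d * a * b : ℕ) : ℝ) * β - round (((d * a * b : ℕ) : ℝ) * β)| ≤ a * b / d := by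
  have ha' : (0 : ℝ) < a := by exact_mod_cast ha
  have hb' : (0 : ℝ) < b := by exact_mod_cast hb
  have hd' : (0 : ℝ) < d := by exact_mod_cast hd
  have h1 : |((d * a * b : ℕ) : ℝ) * α - round (((d * a * b : ℕ) : ℝ) * α)| ≤
      b * (1 / (d * a : ℕ)) := by
    refine (round_le _ (b * p)).trans ?_
    calc _ = b * |((d * a : ℕ) : ℝ) * α - p| := by
          have h : ((d * a * b : ℕ) : ℝ) * α - ((b * p : ℤ) : ℝ) =
              b * (((d * a : ℕ) : ℝ) * α - p) := by
            push_cast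
            ring
          rw [h, abs_mul, abs_of_pos hb']
      _ ≤ _ := by gcongr
  have h2 : |((d * a * b : ℕ) : ℝ) * β - round (((d * a * b : ℕ) : ℝ) * β)| ≤
      a * (1 / (d * b : ℕ)) := by
    refine (round_le _ (a * r)).trans ?_
    calc _ = a * |((d * b : ℕ) : ℝ) * β - r| := by
          have h : ((d * a * b : ℕ) : ℝ) * β - ((a * r : ℤ) : ℝ) =
              a * (((d * b : ℕ) : ℝ) * β - r) := by
            push_cast
            ring
          rw [h, abs_mul, abs_of_pos ha']
      _ ≤ _ := by gcongr
  calc _ ≤ ((d * a * b : ℕ) : ℝ) * (b * (1 / (d * a : ℕ))) * (a * (1 / (d * b : ℕ))) := by gcongr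
    _ = a * b / d := by
      push_cast
      field_simp

theorem le_pow_mul_of_succ_le {q : ℕ → ℕ} {R : ℝ} (hR : 1 ≤ R) (hmono : Monotone q)
    (hq : ∀ n, (q (n + 1) : ℝ) ≤ R * q n) (n : ℕ) {i k : ℕ} (hi : i ≤ k) (j : ℕ) :
    (q (n + i) : ℝ) ≤ R ^ k * q (n + j) := by
  have h : ∀ i, (q (n + i) : ℝ) ≤ R ^ i * q n := by
    intro i
    induction i with
    | zero => simp
    | succ i ih =>
      calc (q (n + i + 1) : ℝ) ≤ R * q (n + i) := hq _
        _ ≤ R * (R ^ i * q n) := by gcongr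
        _ = R ^ (i + 1) * q n := by ring
  have hn : (q n : ℝ) ≤ q (n + j) := by exact_mod_cast hmono (Nat.le_add_right n j)
  calc (q (n + i) : ℝ) ≤ R ^ i * q n := h i
    _ ≤ R ^ k * q (n + j) := by gcongr

/-- Comparability of `d i * b i` passes to `b i`. -/
theorem le_mul_of_comparable {b d b' d' ε S : ℝ} (hb : 0 < b) (hb' : 0 < b') (hε : 0 < ε)
    (hε1 : ε ≤ 1) (hS : 1 ≤ S) (h : ε ^ 3 * b ^ 2 ≤ d) (h' : ε * d' ≤ b' ^ 2)
    (hS' : d * b ≤ S * (d' * b')) : b ≤ S / ε ^ 4 * b' := by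
  set T := S / ε ^ 4 with hT
  have hT1 : 1 ≤ T := by
    rw [hT, le_div_iff₀ (by positivity), one_mul]
    exact (pow_le_one₀ hε.le hε1).trans hS
  have h3 : b ^ 3 ≤ T * b' ^ 3 := by
    rw [hT, div_mul_eq_mul_div, le_div_iff₀ (by positivity)]
    calc b ^ 3 * ε ^ 4 = ε * (ε ^ 3 * b ^ 2 * b) := by ring
      _ ≤ ε * (d * b) := by gcongr
      _ ≤ ε * (S * (d' * b')) := by gcongr
      _ = S * (ε * d' * b') := by ring
      _ ≤ S * (b' ^ 2 * b') := by gcongr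
      _ = S * b' ^ 3 := by ring
  refine le_of_pow_le_pow_left₀ (n := 3) (by norm_num) (by positivity) (h3.trans ?_)
  rw [mul_pow]
  gcongr
  exact le_self_pow₀ hT1 (by norm_num)

/-- Under the denominator conditions, `n * ‖n * α‖ * ‖n * β‖` is not bounded away from zero. -/
theorem not_eventually_le_mul_abs_mul_abs (α β : ℝ)
    (hα : Irrational α) (hβ : Irrational β)
    (hbadα : ∃ C > (0 : ℝ), ∀ q : ℕ, 0 < q →
      C ≤ (q : ℝ) * |(q : ℝ) * α - round ((q : ℝ) * α)|)
    (hbadβ : ∃ C > (0 : ℝ), ∀ q : ℕ, 0 < q →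
      C ≤ (q : ℝ) * |(q : ℝ) * β - round ((q : ℝ) * β)|)
    (η : ℕ → ℝ) (hη : ∀ n, η n < 1 / 3) (n₀ : ℕ)
    (h1 : ∀ n ≥ n₀,
      (GenContFract.of β).dens (2 * n) ^ ((11 : ℝ) / 12 + η n / 4) ≤
          (GenContFract.of α).dens (2 * n) ∧
        (GenContFract.of α).dens (2 * n) ≤ (GenContFract.of β).dens (2 * n))
    (h2 : ∀ n ≥ n₀, ∀ qa qb : ℕ,
      (qa : ℝ) = (GenContFract.of α).dens (2 * n) →
      (qb : ℝ) = (GenContFract.of β).dens (2 * n) →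
      (Nat.lcm qa qb : ℝ) ≤ (GenContFract.of β).dens (2 * n) ^ (1 + η n))
    {ε : ℝ} (hε : 0 < ε) (hε1 : ε ≤ 1) :
    ¬ ∀ᶠ n : ℕ in atTop, ε ≤ (n : ℝ) * |(n : ℝ) * α - round ((n : ℝ) * α)| *
          |(n : ℝ) * β - round ((n : ℝ) * β)| := by
  intro hev
  obtain ⟨N, hN⟩ := eventually_atTop.mp hev
  obtain ⟨p, P, R, hR, hP, hP0, hPmono, hPR, hPdet, hPapp⟩ := hα.exists_even_convergents hbadα
  obtain ⟨r, Q, R', hR', hQ, hQ0, hQmono, hQR, hQdet, hQapp⟩ := hβ.exists_even_convergents hbadβ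
  have hfac : ∀ n, ∃ d a b : ℕ, 0 < d ∧ Nat.Coprime a b ∧ P n = d * a ∧ Q n = d * b := fun n => by
    obtain ⟨a, b, hab, h⟩ := Nat.exists_coprime (P n) (Q n)
    refine ⟨Nat.gcd (P n) (Q n), a, b, Nat.gcd_pos_of_pos_left _ (hP0 n), hab, ?_, ?_⟩
    · rw [mul_comm]; exact h.1
    · rw [mul_comm]; exact h.2
  choose d a b hd0 hcop hPd hQd using hfac
  have ha0 : ∀ n, 0 < a n := fun n => Nat.pos_of_mul_pos_left (hPd n ▸ hP0 n)
  have hb0 : ∀ n, 0 < b n := fun n => Nat.pos_of_mul_pos_left (hQd n ▸ hQ0 n)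
  have hlcm : ∀ n, Nat.lcm (P n) (Q n) = d n * a n * b n := fun n => by
    rw [hPd, hQd, Nat.lcm_mul_left, (hcop n).lcm_eq_mul, mul_assoc]
  have hd0' : ∀ n, (0 : ℝ) < d n := fun n => by exact_mod_cast hd0 n
  have ha0' : ∀ n, (0 : ℝ) < a n := fun n => by exact_mod_cast ha0 n
  have hb0' : ∀ n, (0 : ℝ) < b n := fun n => by exact_mod_cast hb0 n
  have hPr : ∀ n, (P n : ℝ) = d n * a n := fun n => by rw [hPd]; push_cast; rfl
  have hQr : ∀ n, (Q n : ℝ) = d n * b n := fun n => by rw [hQd]; push_cast; rfl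
  have hcomp : ∀ n ≥ max n₀ N, (a n : ℝ) ≤ b n ∧ ε * b n ≤ a n ∧ ε ^ 3 * (b n : ℝ) ^ 2 ≤ d n ∧
      ε * d n ≤ (b n : ℝ) ^ 2 := by
    intro n hn
    have hn₀ : n₀ ≤ n := (le_max_left _ _).trans hn
    have hnN : N ≤ n := (le_max_right _ _).trans hn
    obtain ⟨g1, g2⟩ := h1 n hn₀
    have g3 := h2 n hn₀ _ _ (hP n) (hQ n)
    rw [hlcm] at g3
    push_cast at g3
    rw [← hP, ← hQ, hPr, hQr] at g1 g2
    rw [← hQ, hQr] at g3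
    refine comparable_of_growth (ha0' n) (hb0' n) (hd0' n) hε (hη n) ?_ g1 g2 g3 ?_
    · rw [← hQr]; exact_mod_cast hQ0 n
    · have hL : N ≤ d n * a n * b n := by
        calc N ≤ n := hnN
          _ ≤ P n := hPmono.id_le n
          _ = d n * a n := hPd n
          _ ≤ d n * a n * b n := Nat.le_mul_of_pos_right _ (hb0 n)
      have hA := hPapp n
      have hB := hQapp n
      rw [hPd] at hA
      rw [hQd] at hB
      have := (hN _ hL).trans
        (mul_abs_mul_abs_le_of_common_factor (ha0 n) (hb0 n) (hd0 n) hA hB)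
      rwa [le_div_iff₀ (hd0' n)] at this
  set S := max R R' ^ 4 with hS
  have hS1 : 1 ≤ S := one_le_pow₀ (hR.trans (le_max_left _ _))
  have hPS : ∀ n (i j : Fin 5), (P (n + i) : ℝ) ≤ S * P (n + j) := fun n i j =>
    le_pow_mul_of_succ_le (hR.trans (le_max_left _ _)) hPmono.monotone
      (fun n => (hPR n).trans (by gcongr; exact le_max_left _ _)) n (by lia) j
  have hQS : ∀ n (i j : Fin 5), (Q (n + i) : ℝ) ≤ S * Q (n + j) := fun n i j =>
    le_pow_mul_of_succ_le (hR.trans (le_max_left _ _)) hQmono.monotone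
      (fun n => (hQR n).trans (by gcongr; exact le_max_right _ _)) n (by lia) j
  set T := S / ε ^ 4 with hT
  have hST : S ≤ T := by
    rw [hT, le_div_iff₀ (by positivity)]
    exact mul_le_of_le_one_right (by positivity) (pow_le_one₀ hε.le hε1)
  have hT1 : 1 ≤ T := hS1.trans hST
  have hTpos : 0 < T := by positivity
  set K : ℤ := ⌈2 * (T ^ 2 / ε ^ 3)⌉ with hK
  have hTT : T ≤ T ^ 2 / ε ^ 3 := by
    rw [le_div_iff₀ (by positivity)]
    calc T * ε ^ 3 ≤ T * T := by gcongr; exact (pow_le_one₀ hε.le hε1).trans hT1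
      _ = T ^ 2 := by ring
  have hTε : T / ε ≤ T ^ 2 / ε ^ 3 := by
    rw [div_le_div_iff₀ (by positivity) (by positivity)]
    calc T * ε ^ 3 = T * (ε * ε ^ 2) := by ring
      _ ≤ T * (ε * T) := by gcongr; exact (pow_le_one₀ hε.le hε1).trans hT1
      _ = T ^ 2 * ε := by ring
  have hKle : 2 * (T ^ 2 / ε ^ 3) ≤ K := Int.le_ceil _
  have hK1 : 1 ≤ K := by
    have : (1 : ℝ) ≤ K := by linarith
    exact_mod_cast this
  have hbound : ∀ n ≥ max n₀ N, (b n : ℤ) ≤ 8 * K ^ 24 := by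
    intro n hn
    have hni : ∀ i : Fin 5, n + (i : ℕ) ≥ max n₀ N := fun i => by lia
    have hbT : ∀ i j : Fin 5, (b (n + i) : ℝ) ≤ T * b (n + j) := fun i j =>
      le_mul_of_comparable (hb0' _) (hb0' _) hε hε1 hS1 (hcomp _ (hni i)).2.2.1
        (hcomp _ (hni j)).2.2.2 (by rw [← hQr, ← hQr]; exact hQS n i j)
    have hb1 : ∀ i : Fin 5, (b (n + i) : ℝ) ≤ K * b n := fun i => by
      calc (b (n + i) : ℝ) ≤ T * b n := hbT i 0
        _ ≤ K * b n := by gcongr; linarith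
    have hb2 : ∀ i : Fin 5, (b n : ℝ) ≤ T * b (n + i) := fun i => hbT 0 i
    refine BalancedFractions.le_bound (a := fun i => a (n + i)) (b := fun i => b (n + i))
      (d := fun i => d (n + i)) (p := fun i => p (n + i)) (r := fun i => r (n + i)) ?_ hK1
    constructor
    · intro i
      exact Nat.isCoprime_iff_coprime.mpr (hcop _)
    · intro i
      have : (b n : ℝ) ≤ K * a (n + i) := by
        calc (b n : ℝ) ≤ T * b (n + i) := hb2 i
          _ = T / ε * (ε * b (n + i)) := by field_simp
          _ ≤ K * a (n + i) := by
            gcongr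
            · linarith
            · exact (hcomp _ (hni i)).2.1
      exact_mod_cast this
    · intro i
      have := (hcomp _ (hni i)).1.trans (hb1 i)
      exact_mod_cast this
    · intro i
      have : (b n : ℝ) ≤ K * b (n + i) := (hb2 i).trans (by gcongr; linarith)
      exact_mod_cast this
    · intro i
      exact_mod_cast hb1 i
    · intro i
      have : (b n : ℝ) ^ 2 ≤ K * d (n + i) := by
        calc (b n : ℝ) ^ 2 ≤ (T * b (n + i)) ^ 2 := by gcongr; exact hb2 i
          _ = T ^ 2 / ε ^ 3 * (ε ^ 3 * b (n + i) ^ 2) := by field_simp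
          _ ≤ K * d (n + i) := by
            gcongr
            · linarith
            · exact (hcomp _ (hni i)).2.2.1
      exact_mod_cast this
    · intro i j hij
      have := hPdet (n + i) (n + j) (by lia)
      rw [hPd, hPd] at this
      exact_mod_cast this
    · intro i j
      have h := abs_det_le_of_approx (hP0 _) (hP0 _) (hPapp (n + i)) (hPapp (n + j)) (hPS n i j)
        (hPS n j i)
      rw [hPd, hPd] at h
      have h' := h.trans (by linarith : 2 * S ≤ K)
      exact_mod_cast h'
    · intro i j hij
      have := hQdet (n + i) (n + j) (by lia)
      rw [hQd, hQd] at this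
      exact_mod_cast this
    · intro i j
      have h := abs_det_le_of_approx (hQ0 _) (hQ0 _) (hQapp (n + i)) (hQapp (n + j)) (hQS n i j)
        (hQS n j i)
      rw [hQd, hQd] at h
      have h' := h.trans (by linarith : 2 * S ≤ K)
      exact_mod_cast h'
  obtain ⟨m, hm⟩ := exists_nat_gt ((8 * (K : ℝ) ^ 24) ^ 3 / ε)
  set n := max m (max n₀ N)
  have hn : n ≥ max n₀ N := le_max_right _ _
  have hbn : (b n : ℝ) ≤ 8 * (K : ℝ) ^ 24 := by exact_mod_cast hbound n hn
  have hQn : (Q n : ℝ) ≤ (8 * (K : ℝ) ^ 24) ^ 3 / ε := by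
    rw [le_div_iff₀ hε, hQr]
    calc (d n : ℝ) * b n * ε = ε * d n * b n := by ring
      _ ≤ (b n : ℝ) ^ 2 * b n := by gcongr; exact (hcomp n hn).2.2.2
      _ = (b n : ℝ) ^ 3 := by ring
      _ ≤ _ := by gcongr
  have hmQ : (m : ℝ) ≤ Q n := by exact_mod_cast (le_max_left _ _).trans (hQmono.id_le n)
  linarith

/-- Main theorem: let `α, β` be irrational badly approximable reals.  If there are a
sequence `(η_n)` with `0 ≤ η_n < 1/3` and an index `n₀` such that for all `n ≥ n₀`
the denominators `q_{2n}` of the regular continued fraction convergents satisfy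
`q_{2n}(β)^{11/12 + η_n/4} ≤ q_{2n}(α) ≤ q_{2n}(β)` and
`lcm(q_{2n}(α), q_{2n}(β)) ≤ q_{2n}(β)^{1 + η_n}`, then `(α, β)` satisfies the
Littlewood conjecture: `liminf n·‖nα‖·‖nβ‖ = 0`, where `‖t‖ = |t - round t|`. -/
theorem littlewood_of_denominator_conditions (α β : ℝ)
    (hα : Irrational α) (hβ : Irrational β)
    (hbadα : ∃ C > (0 : ℝ), ∀ q : ℕ, 0 < q →
      C ≤ (q : ℝ) * |(q : ℝ) * α - round ((q : ℝ) * α)|)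
    (hbadβ : ∃ C > (0 : ℝ), ∀ q : ℕ, 0 < q →
      C ≤ (q : ℝ) * |(q : ℝ) * β - round ((q : ℝ) * β)|)
    (η : ℕ → ℝ) (hη : ∀ n, 0 ≤ η n ∧ η n < 1 / 3)
    (n₀ : ℕ)
    (h1 : ∀ n ≥ n₀,
      (GenContFract.of β).dens (2 * n) ^ ((11 : ℝ) / 12 + η n / 4) ≤
          (GenContFract.of α).dens (2 * n) ∧
        (GenContFract.of α).dens (2 * n) ≤ (GenContFract.of β).dens (2 * n))
    (h2 : ∀ n ≥ n₀, ∀ qa qb : ℕ,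
      (qa : ℝ) = (GenContFract.of α).dens (2 * n) →
      (qb : ℝ) = (GenContFract.of β).dens (2 * n) →
      (Nat.lcm qa qb : ℝ) ≤ (GenContFract.of β).dens (2 * n) ^ (1 + η n)) :
    liminf (fun n : ℕ =>
        (n : ℝ) * |(n : ℝ) * α - round ((n : ℝ) * α)| *
          |(n : ℝ) * β - round ((n : ℝ) * β)|) atTop = 0 := by
  have hnonneg : ∀ n : ℕ, 0 ≤ (n : ℝ) * |(n : ℝ) * α - round ((n : ℝ) * α)| *
      |(n : ℝ) * β - round ((n : ℝ) * β)| := fun n => by positivity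
  have hfreq : ∀ ε > (0 : ℝ), ∃ᶠ n : ℕ in atTop,
      (n : ℝ) * |(n : ℝ) * α - round ((n : ℝ) * α)| *
        |(n : ℝ) * β - round ((n : ℝ) * β)| ≤ ε := by
    intro ε hε
    have h := not_eventually_le_mul_abs_mul_abs α β hα hβ hbadα hbadβ η (fun n => (hη n).2) n₀ h1 h2
      (lt_min hε one_pos) (min_le_right ε 1)
    refine (not_eventually.mp h).mono fun n hn => ?_
    exact (not_le.mp hn).le.trans (min_le_left _ _)
  refine le_antisymm (le_of_forall_pos_le_add fun ε hε => ?_) ?_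
  · rw [zero_add]
    exact liminf_le_of_frequently_le (hfreq ε hε) (isBoundedUnder_of ⟨0, hnonneg⟩)
  · exact le_liminf_of_le (IsCoboundedUnder.of_frequently_le (hfreq 1 one_pos))
      (Eventually.of_forall hnonneg)
end

section
/- Let α and β be irrational real numbers, n a natural number, and set A_n := e_{2n}(α)·e_{2n}(β) > 0. Then for every ε > 0 and all real numbers r₁, r₂, r₃, the Lebesgue measure of the set { t ∈ ℝ : |A_n·(t − r₁)(t − r₂)(t − r₃)| ≤ ε } is at most 6e·(4ε)^{1/3}·(q_{2n+1}(α)·q_{2n+1}(β))^{2/3}. -/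
open MeasureTheory

/-- The denominators of the convergents of a real number are at least one. -/
theorem one_le_dens (v : ℝ) (n : ℕ) : 1 ≤ (GenContFract.of v).dens n :=
  GenContFract.zeroth_den_eq_one (g := GenContFract.of v) ▸
    monotone_nat_of_le_succ (f := (GenContFract.of v).dens)
      (fun _ => GenContFract.of_den_mono) (Nat.zero_le n)

/-- Lower bound for the error of the `n`-th convergent of an irrational number in terms of the
next denominator. -/
theorem one_div_two_mul_sq_dens_succ_le_abs_sub_convs {v : ℝ} (hv : Irrational v) (n : ℕ) :
    1 / (2 * (GenContFract.of v).dens (n + 1) ^ 2) ≤ |v - (GenContFract.of v).convs n| := by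
  have hnt : ¬ (GenContFract.of v).TerminatedAt n := fun h => by
    obtain ⟨q, hq⟩ := (GenContFract.terminates_iff_rat v).1 ⟨n, h⟩
    exact hv ⟨q, hq.symm⟩
  have hsucc : GenContFract.IntFractPair.stream v (n + 1) ≠ none :=
    (not_congr
      GenContFract.of_terminatedAt_n_iff_succ_nth_intFractPair_stream_eq_none).1 hnt
  obtain ⟨p', hp'⟩ := Option.ne_none_iff_exists'.1 hsucc
  obtain ⟨p, hp, hfr, hpp'⟩ := GenContFract.IntFractPair.succ_nth_stream_eq_some_iff.1 hp'
  have hs := GenContFract.get?_of_eq_some_of_succ_get?_intFractPair_stream hp'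
  have hrec := congrArg GenContFract.Pair.b
    (GenContFract.contsAux_recurrence (g := GenContFract.of v) (n := n) hs rfl rfl)
  simp only [one_mul] at hrec
  have herr := GenContFract.sub_convs_eq hp
  simp only [hfr, if_false] at herr
  have hfrpos : 0 < p.fr :=
    (GenContFract.IntFractPair.nth_stream_fr_nonneg hp).lt_of_ne' hfr
  have hinv : p.fr⁻¹ < (p'.b : ℝ) + 1 := by
    rw [← hpp']
    exact Int.lt_floor_add_one _
  have hmono : (GenContFract.of v).dens n ≤ (GenContFract.of v).dens (n + 1) :=
    GenContFract.of_den_mono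
  have hone : (1 : ℝ) ≤ (GenContFract.of v).dens n :=
    one_le_dens v n
  have hprev : 0 ≤ ((GenContFract.of v).contsAux n).b := GenContFract.zero_le_of_contsAux_b
  rw [GenContFract.den_eq_conts_b, GenContFract.den_eq_conts_b,
    GenContFract.nth_cont_eq_succ_nth_contAux,
    GenContFract.nth_cont_eq_succ_nth_contAux] at hmono
  rw [GenContFract.den_eq_conts_b, GenContFract.nth_cont_eq_succ_nth_contAux] at hone
  rw [herr, abs_div, abs_pow, abs_neg, abs_one, one_pow, GenContFract.den_eq_conts_b,
    GenContFract.nth_cont_eq_succ_nth_contAux]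
  set B := ((GenContFract.of v).contsAux (n + 1)).b
  set P := ((GenContFract.of v).contsAux n).b
  set C := ((GenContFract.of v).contsAux (n + 1 + 1)).b
  have hinv0 : 0 < p.fr⁻¹ := inv_pos.2 hfrpos
  have hsum : p.fr⁻¹ * B + P ≤ 2 * C := by nlinarith
  have hpos : 0 < B * (p.fr⁻¹ * B + P) := by positivity
  rw [abs_of_pos hpos]
  refine one_div_le_one_div_of_le hpos ?_
  nlinarith [mul_le_mul hmono hsum (by positivity) (by linarith)]

/-- The set where a product of three linear factors is at most `d ^ 3` in absolute value has
measure at most `6 * d`. -/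
theorem volume_abs_cubic_le (d : ℝ) (hd : 0 ≤ d) (r₁ r₂ r₃ : ℝ) :
    volume {t : ℝ | |(t - r₁) * (t - r₂) * (t - r₃)| ≤ d ^ 3} ≤ ENNReal.ofReal (6 * d) := by
  have hsub : {t : ℝ | |(t - r₁) * (t - r₂) * (t - r₃)| ≤ d ^ 3} ⊆
      Metric.closedBall r₁ d ∪ Metric.closedBall r₂ d ∪ Metric.closedBall r₃ d := by
    intro t ht
    simp only [Set.mem_union, Metric.mem_closedBall, Real.dist_eq]
    by_contra! h
    obtain ⟨⟨h₁, h₂⟩, h₃⟩ := h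
    rw [Set.mem_ofPred_eq] at ht
    refine absurd ht (not_le.2 ?_)
    rw [abs_mul, abs_mul, show d ^ 3 = d * d * d by ring]
    gcongr
  calc _ ≤ _ := measure_mono hsub
    _ ≤ volume (Metric.closedBall r₁ d) + volume (Metric.closedBall r₂ d) +
        volume (Metric.closedBall r₃ d) :=
      (measure_union_le _ _).trans (add_le_add_left (measure_union_le _ _) _)
    _ = ENNReal.ofReal (6 * d) := by
      simp only [Real.volume_closedBall]
      rw [← ENNReal.ofReal_add (by positivity) (by positivity),
        ← ENNReal.ofReal_add (by positivity) (by positivity)]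
      congr 1
      ring

/-- Cartan-type measure bound for the auxiliary cubic: for irrational `α, β`, with
`A_n := e_{2n}(α)·e_{2n}(β) > 0` (where `e_m(γ) = γ - p_m(γ)/q_m(γ)` is the error of
the `m`-th convergent), for every `ε > 0` and all reals `r₁, r₂, r₃`, the measure of
`{t : |A_n (t - r₁)(t - r₂)(t - r₃)| ≤ ε}` is at most
`6e·(4ε)^{1/3}·(q_{2n+1}(α)·q_{2n+1}(β))^{2/3}`. -/
theorem measure_small_values_auxiliary_cubic (α β : ℝ)
    (hα : Irrational α) (hβ : Irrational β) (n : ℕ) (A : ℝ)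
    (hA : A = (α - (GenContFract.of α).convs (2 * n)) *
        (β - (GenContFract.of β).convs (2 * n)))
    (ε : ℝ) (hε : 0 < ε) (r₁ r₂ r₃ : ℝ) :
    volume {t : ℝ | |A * ((t - r₁) * (t - r₂) * (t - r₃))| ≤ ε} ≤
      ENNReal.ofReal (6 * Real.exp 1 * (4 * ε) ^ ((1 : ℝ) / 3) *
        ((GenContFract.of α).dens (2 * n + 1) *
            (GenContFract.of β).dens (2 * n + 1)) ^ ((2 : ℝ) / 3)) := by
  have hlower := fun (v : ℝ) (hv : Irrational v) =>
    one_div_two_mul_sq_dens_succ_le_abs_sub_convs hv (2 * n)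
  have hden : ∀ v : ℝ, 0 < (GenContFract.of v).dens (2 * n + 1) := fun v =>
    zero_lt_one.trans_le (one_le_dens v _)
  have ha := hlower α hα
  have hb := hlower β hβ
  have hqa := hden α
  have hqb := hden β
  set a := (GenContFract.of α).dens (2 * n + 1)
  set b := (GenContFract.of β).dens (2 * n + 1)
  have hAabs : 1 / (4 * (a * b) ^ 2) ≤ |A| := by
    rw [hA, abs_mul]
    calc 1 / (4 * (a * b) ^ 2) = 1 / (2 * a ^ 2) * (1 / (2 * b ^ 2)) := by
          field_simp
          norm_num
      _ ≤ _ := mul_le_mul ha hb (by positivity) (abs_nonneg _)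
  set d : ℝ := (4 * ε) ^ ((1 : ℝ) / 3) * (a * b) ^ ((2 : ℝ) / 3) with hd_def
  have hd : 0 ≤ d := by positivity
  have hd3 : d ^ 3 = 4 * ε * (a * b) ^ 2 := by
    rw [hd_def, mul_pow, ← Real.rpow_mul_natCast (by positivity),
      ← Real.rpow_mul_natCast (by positivity)]
    norm_num
  refine ((measure_mono fun t ht => ?_).trans (volume_abs_cubic_le d hd r₁ r₂ r₃)).trans
    (ENNReal.ofReal_le_ofReal ?_)
  · rw [Set.mem_ofPred_eq] at ht ⊢
    rw [abs_mul] at ht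
    have h := (mul_le_mul_of_nonneg_right hAabs
      (abs_nonneg ((t - r₁) * (t - r₂) * (t - r₃)))).trans ht
    rw [one_div_mul_eq_div, div_le_iff₀ (by positivity)] at h
    rw [hd3]
    linarith
  · have he : 1 ≤ Real.exp 1 := Real.one_le_exp zero_le_one
    rw [mul_assoc (6 * Real.exp 1)]
    exact mul_le_mul_of_nonneg_right (by linarith) hd
end

section
/- Fix a real number η with 0 < η < 1/3. Then there exist positive integers a and b with a < b such that, denoting for each positive integer m by (q^{(m)}_n)_{n≥0} the sequence defined by q^{(m)}_0 = 1, q^{(m)}_1 = m, and q^{(m)}_{n+1} = m·q^{(m)}_n + q^{(m)}_{n−1} for n ≥ 1, there is an index n₀ with (q^{(b)}_{2n})^{11/12 + η/4} ≤ q^{(a)}_{2n} ≤ q^{(b)}_{2n} for all n ≥ n₀. -/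
/-- Denominators of the convergents of `[m; m, m, …]`. -/
def qrec (m : ℕ) : ℕ → ℕ
  | 0 => 1
  | 1 => m
  | n + 2 => m * qrec m (n + 1) + qrec m n

lemma qrec_mono {a b : ℕ} (h : a ≤ b) (n : ℕ) : qrec a n ≤ qrec b n := by
  induction n using Nat.twoStepInduction with
  | zero => exact le_rfl
  | one => exact h
  | more n ih₀ ih₁ => exact Nat.add_le_add (Nat.mul_le_mul h ih₁) ih₀

lemma pow_le_qrec (m n : ℕ) : m ^ n ≤ qrec m n := by
  induction n using Nat.twoStepInduction with
  | zero => simp [qrec]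
  | one => simp [qrec]
  | more n ih₀ ih₁ =>
    calc m ^ (n + 2) = m * m ^ (n + 1) := by ring
      _ ≤ m * qrec m (n + 1) := Nat.mul_le_mul_left m ih₁
      _ ≤ qrec m (n + 2) := Nat.le_add_right _ _

lemma qrec_le_pow (m n : ℕ) : qrec m n ≤ (m + 1) ^ n := by
  induction n using Nat.twoStepInduction with
  | zero => simp [qrec]
  | one => simp [qrec]
  | more n ih₀ ih₁ =>
    calc qrec m (n + 2) ≤ m * (m + 1) ^ (n + 1) + (m + 1) ^ n :=
          Nat.add_le_add (Nat.mul_le_mul_left m ih₁) ih₀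
      _ ≤ m * (m + 1) ^ (n + 1) + (m + 1) ^ (n + 1) :=
          Nat.add_le_add_left (Nat.pow_le_pow_right m.succ_pos n.le_succ) _
      _ = (m + 1) ^ (n + 2) := by ring

lemma exists_add_two_rpow_le {s : ℝ} (hs0 : 0 ≤ s) (hs1 : s < 1) :
    ∃ a : ℕ, 0 < a ∧ ((a : ℝ) + 2) ^ s ≤ a := by
  have htendsto : Filter.Tendsto (fun a : ℕ => (a : ℝ) ^ (1 - s)) Filter.atTop Filter.atTop :=
    (tendsto_rpow_atTop (sub_pos.2 hs1)).comp tendsto_natCast_atTop_atTop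
  obtain ⟨a, ha3, ha1⟩ :=
    ((htendsto.eventually_ge_atTop 3).and (Filter.eventually_ge_atTop 1)).exists
  have ha : (1 : ℝ) ≤ a := by exact_mod_cast ha1
  refine ⟨a, ha1, ?_⟩
  calc ((a : ℝ) + 2) ^ s ≤ (3 * a) ^ s :=
        Real.rpow_le_rpow (by positivity) (by linarith) hs0
    _ = 3 ^ s * (a : ℝ) ^ s := Real.mul_rpow (by norm_num) (by positivity)
    _ ≤ (a : ℝ) ^ (1 - s) * (a : ℝ) ^ s := by
        gcongr
        exact (Real.rpow_le_self_of_one_le (by norm_num) hs1.le).trans ha3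
    _ = a := by rw [← Real.rpow_add (by linarith), sub_add_cancel, Real.rpow_one]

/-- For every `η` with `0 < η < 1/3` there are positive integers `a < b` such that the
denominators of the convergents of `[a; a, a, …]` and `[b; b, b, …]` eventually satisfy
`(q^{(b)}_{2n})^{11/12 + η/4} ≤ q^{(a)}_{2n} ≤ q^{(b)}_{2n}`. -/
theorem exists_pair_with_denominator_condition (η : ℝ) (hη0 : 0 < η) (hη1 : η < 1 / 3) :
    ∃ a b : ℕ, 0 < a ∧ a < b ∧
      ∃ n₀ : ℕ, ∀ n ≥ n₀,
        ((qrec b (2 * n) : ℝ)) ^ ((11 : ℝ) / 12 + η / 4) ≤ (qrec a (2 * n) : ℝ) ∧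
          (qrec a (2 * n) : ℝ) ≤ (qrec b (2 * n) : ℝ) := by
  have hs0 : 0 ≤ (11 : ℝ) / 12 + η / 4 := by linarith
  obtain ⟨a, ha, hpow⟩ := exists_add_two_rpow_le hs0 (by linarith)
  refine ⟨a, a + 1, ha, a.lt_succ_self, 0, fun n _ => ⟨?_, ?_⟩⟩
  · have hb : (qrec (a + 1) (2 * n) : ℝ) ≤ ((a : ℝ) + 2) ^ (2 * n) := by
      exact_mod_cast qrec_le_pow (a + 1) (2 * n)
    calc (qrec (a + 1) (2 * n) : ℝ) ^ ((11 : ℝ) / 12 + η / 4)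
        ≤ (((a : ℝ) + 2) ^ (2 * n)) ^ ((11 : ℝ) / 12 + η / 4) :=
          Real.rpow_le_rpow (by positivity) hb hs0
      _ = (((a : ℝ) + 2) ^ ((11 : ℝ) / 12 + η / 4)) ^ (2 * n) :=
          (Real.rpow_pow_comm (by positivity) _ _).symm
      _ ≤ (a : ℝ) ^ (2 * n) := by gcongr
      _ ≤ (qrec a (2 * n) : ℝ) := by exact_mod_cast pow_le_qrec a (2 * n)
  · exact_mod_cast qrec_mono a.le_succ (2 * n)
end

section
/- Let α and β be irrational real numbers and C > 0 a constant with ‖qα‖ ≥ C/q and ‖qβ‖ ≥ C/q for every positive integer q. Let ε > 0, let N be a positive integer, and let x, y, z be integers with 1 ≤ x ≤ N, δ_α := |αx − y| ≤ N^{−1/2}, δ_β := |βx − z| ≤ N^{−1/2}, and x·δ_α·δ_β ≥ ε. Then there exist constants c₁, c₂ > 0 depending only on ε and C (and not on n, N, x, y, z) such that for every n ∈ ℕ: c₁ · q_{2n}(α)² q_{2n}(β)² ≤ x · (δ_α / e_{2n}(α)) · (δ_β / e_{2n}(β)) ≤ c₂ · q_{2n}(α)² q_{2n}(β)². -/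
namespace GenContFract

open GenContFract (of)

/-- The continued fraction of an irrational number never terminates. -/
theorem not_terminatedAt_of_irrational {v : ℝ} (hv : Irrational v) (n : ℕ) :
    ¬(of v).TerminatedAt n := by
  intro h
  obtain ⟨q, hq⟩ := (terminates_iff_rat v).1 ⟨n, h⟩
  exact hv ⟨q, hq.symm⟩

/-- The auxiliary continuants of a computed continued fraction are integers. -/
theorem exists_int_contsAux_eq (v : ℝ) (n : ℕ) :
    ∃ a b : ℤ, (of v).contsAux n = ⟨(a : ℝ), (b : ℝ)⟩ := by
  induction n using Nat.twoStepInduction with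
  | zero => exact ⟨1, 0, by simp⟩
  | one => exact ⟨⌊v⌋, 1, by simp [of_h_eq_floor]⟩
  | more n ih₀ ih₁ =>
    obtain ⟨a₀, b₀, h₀⟩ := ih₀
    obtain ⟨a₁, b₁, h₁⟩ := ih₁
    rcases hs : (of v).s.get? n with _ | gp
    · exact ⟨a₁, b₁, by rw [contsAux_stable_step_of_terminated hs, h₁]⟩
    · obtain ⟨ha, z, hz⟩ := of_partNum_eq_one_and_exists_int_partDen_eq hs
      exact ⟨z * a₁ + a₀, z * b₁ + b₀, by simp [contsAux_recurrence hs h₀ h₁, ha, hz]⟩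

theorem dens_pos_of_irrational {v : ℝ} (hv : Irrational v) (n : ℕ) : 0 < (of v).dens n :=
  (Nat.cast_pos.2 (Nat.fib_pos.2 n.succ_pos)).trans_le
    (succ_nth_fib_le_of_nth_den (Or.inr (not_terminatedAt_of_irrational hv _)))

/-- The convergents of an irrational number approximate it with error at most `1 / q²`. -/
theorem abs_sub_convs_mul_sq_le_one {v : ℝ} (hv : Irrational v) (n : ℕ) :
    |v - (of v).convs n| * (of v).dens n ^ 2 ≤ 1 := by
  have hq := dens_pos_of_irrational hv n
  have hq' := dens_pos_of_irrational hv (n + 1)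
  have h := abs_sub_convs_le (not_terminatedAt_of_irrational hv n)
  rw [le_div_iff₀ (by positivity)] at h
  refine le_trans ?_ h
  rw [sq]
  gcongr
  exact of_den_mono

/-- The convergents of a badly approximable number with constant `C` are at distance at least
`C / q²` from it. -/
theorem le_abs_sub_convs_mul_sq {v C : ℝ} (hv : Irrational v)
    (h : ∀ q : ℕ, 0 < q → C / (q : ℝ) ≤ |(q : ℝ) * v - round ((q : ℝ) * v)|) (n : ℕ) :
    C ≤ |v - (of v).convs n| * (of v).dens n ^ 2 := by
  have hq := dens_pos_of_irrational hv n
  obtain ⟨a, b, hab⟩ := exists_int_contsAux_eq v (n + 1)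
  have hb : (of v).dens n = b := by rw [den_eq_conts_b, nth_cont_eq_succ_nth_contAux, hab]
  have ha : (of v).nums n = a := by rw [num_eq_conts_a, nth_cont_eq_succ_nth_contAux, hab]
  rw [conv_eq_num_div_den, ha, hb]
  rw [hb] at hq
  lift b to ℕ using (Int.cast_pos.1 hq).le
  rw [Int.cast_natCast] at hq ⊢
  have key := (h b (Nat.cast_pos.1 hq)).trans (round_le _ a)
  rw [div_le_iff₀ hq] at key
  have hmul : (b : ℝ) * v - a = (v - a / b) * b := by field_simp
  rwa [hmul, abs_mul, abs_of_pos hq, mul_assoc, ← sq] at key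

theorem sub_convs_even_nonneg {v : ℝ} (hv : Irrational v) (n : ℕ) :
    0 ≤ v - (of v).convs (2 * n) := by
  have hs := not_terminatedAt_of_irrational hv (2 * n)
  rw [of_terminatedAt_n_iff_succ_nth_intFractPair_stream_eq_none] at hs
  obtain ⟨ifp', h'⟩ := Option.ne_none_iff_exists'.1 hs
  obtain ⟨ifp, h, -, -⟩ := IntFractPair.succ_nth_stream_eq_some_iff.1 h'
  rw [sub_convs_eq h]
  have hfr := IntFractPair.nth_stream_fr_nonneg h
  have hB : 0 ≤ ((of v).contsAux (2 * n + 1)).b := zero_le_of_contsAux_b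
  have hpB : 0 ≤ ((of v).contsAux (2 * n)).b := zero_le_of_contsAux_b
  split_ifs
  · exact le_rfl
  · rw [pow_mul]
    norm_num
    positivity

end GenContFract


/-- Estimate for the third elementary symmetric function `Σ₃ = x·(δ_α/e_{2n}(α))·(δ_β/e_{2n}(β))`
of the roots of the auxiliary cubic: it is comparable to `q_{2n}(α)²·q_{2n}(β)²`, with
constants depending only on `ε` and the bad-approximability constant `C`. -/
theorem sigma3_estimate (ε C : ℝ) (hε : 0 < ε) (hC : 0 < C) :
    ∃ c₁ c₂ : ℝ, 0 < c₁ ∧ 0 < c₂ ∧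
      ∀ α β : ℝ, Irrational α → Irrational β →
        (∀ q : ℕ, 0 < q → C / (q : ℝ) ≤ |(q : ℝ) * α - round ((q : ℝ) * α)|) →
        (∀ q : ℕ, 0 < q → C / (q : ℝ) ≤ |(q : ℝ) * β - round ((q : ℝ) * β)|) →
        ∀ N : ℕ, 0 < N → ∀ x y z : ℤ,
          1 ≤ x → (x : ℝ) ≤ N →
          |α * x - y| ≤ (N : ℝ) ^ (-(1 : ℝ) / 2) →
          |β * x - z| ≤ (N : ℝ) ^ (-(1 : ℝ) / 2) →
          ε ≤ (x : ℝ) * |α * x - y| * |β * x - z| →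
          ∀ n : ℕ,
            c₁ * ((GenContFract.of α).dens (2 * n) ^ 2 *
                (GenContFract.of β).dens (2 * n) ^ 2) ≤
              (x : ℝ) * (|α * x - y| / (α - (GenContFract.of α).convs (2 * n))) *
                (|β * x - z| / (β - (GenContFract.of β).convs (2 * n))) ∧
            (x : ℝ) * (|α * x - y| / (α - (GenContFract.of α).convs (2 * n))) *
                (|β * x - z| / (β - (GenContFract.of β).convs (2 * n))) ≤
              c₂ * ((GenContFract.of α).dens (2 * n) ^ 2 *
                (GenContFract.of β).dens (2 * n) ^ 2) := by
  refine ⟨ε, 1 / C ^ 2, hε, by positivity, ?_⟩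
  intro α β hα hβ hCα hCβ N hN x y z hx hxN hy hz hxyz n
  have hEα := GenContFract.sub_convs_even_nonneg hα n
  have hEβ := GenContFract.sub_convs_even_nonneg hβ n
  have hlα := GenContFract.le_abs_sub_convs_mul_sq hα hCα (2 * n)
  have hlβ := GenContFract.le_abs_sub_convs_mul_sq hβ hCβ (2 * n)
  have huα := GenContFract.abs_sub_convs_mul_sq_le_one hα (2 * n)
  have huβ := GenContFract.abs_sub_convs_mul_sq_le_one hβ (2 * n)
  rw [abs_of_nonneg hEα] at hlα huα
  rw [abs_of_nonneg hEβ] at hlβ huβ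
  have hprod : (x : ℝ) * |α * x - y| * |β * x - z| ≤ 1 := by
    have hN' : (0 : ℝ) < N := Nat.cast_pos.2 hN
    calc (x : ℝ) * |α * x - y| * |β * x - z|
        ≤ N * (N : ℝ) ^ (-(1 : ℝ) / 2) * (N : ℝ) ^ (-(1 : ℝ) / 2) := by gcongr
      _ = 1 := by
        rw [mul_assoc, ← Real.rpow_add hN']
        norm_num [Real.rpow_neg_one, hN'.ne']
  generalize α - (GenContFract.of α).convs (2 * n) = e at *
  generalize β - (GenContFract.of β).convs (2 * n) = f at *
  generalize (GenContFract.of α).dens (2 * n) ^ 2 = A at *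
  generalize (GenContFract.of β).dens (2 * n) ^ 2 = B at *
  have he : 0 < e := hEα.lt_of_ne (by rintro rfl; linarith)
  have hf : 0 < f := hEβ.lt_of_ne (by rintro rfl; linarith)
  have hlow : C ^ 2 ≤ (e * A) * (f * B) := by
    rw [sq]
    exact mul_le_mul hlα hlβ hC.le (hC.le.trans hlα)
  have hupp : (e * A) * (f * B) ≤ 1 := mul_le_one₀ huα (hC.le.trans hlβ) huβ
  have heq : (x : ℝ) * (|α * x - y| / e) * (|β * x - z| / f) =
      (x : ℝ) * |α * x - y| * |β * x - z| / (e * f) := by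
    field_simp
  rw [heq]
  constructor
  · rw [le_div_iff₀ (by positivity)]
    calc ε * (A * B) * (e * f) = ε * ((e * A) * (f * B)) := by ring
      _ ≤ ε := mul_le_of_le_one_right hε.le hupp
      _ ≤ _ := hxyz
  · rw [div_le_iff₀ (by positivity)]
    calc (x : ℝ) * |α * x - y| * |β * x - z| ≤ 1 := hprod
      _ ≤ (e * A) * (f * B) / C ^ 2 := (one_le_div (by positivity)).2 hlow
      _ = 1 / C ^ 2 * (A * B) * (e * f) := by ring
end

section
/- Let α and β be irrational real numbers and C > 0 a constant with ‖qα‖ ≥ C/q and ‖qβ‖ ≥ C/q for every positive integer q. Let ε > 0, let N be a positive integer, and let x, y, z be integers with 1 ≤ x ≤ N, δ_α := |αx − y| ≤ N^{−1/2}, δ_β := |βx − z| ≤ N^{−1/2}, and x·δ_α·δ_β ≥ ε. Write t(α) := δ_α/e_{2n}(α) and t(β) := δ_β/e_{2n}(β). Then there exist constants c₁, c₂ > 0 depending only on ε and C (and not on n, N, x, y, z) such that for every n ∈ ℕ: c₁·( q_{2n}(α)² q_{2n}(β)²/N + q_{2n}(α)² + q_{2n}(β)² ) ≤ x·t(α)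 + x·t(β) + t(α)·t(β) ≤ c₂·( q_{2n}(α)² q_{2n}(β)²/N + √N·(q_{2n}(α)² + q_{2n}(β)²) ). -/
open GenContFract in
theorem GenContFract.exists_int_contsAux_of {K : Type*} [Field K] [LinearOrder K] [FloorRing K]
    [IsStrictOrderedRing K] (v : K) (n : ℕ) :
    ∃ a b : ℤ, (GenContFract.of v).contsAux n = ⟨(a : K), (b : K)⟩ := by
  induction n using Nat.strong_induction_on with
  | _ n ih =>
    rcases n with (_ | _ | n)
    · exact ⟨1, 0, by simp [contsAux]⟩
    · exact ⟨⌊v⌋, 1, by simp [contsAux, of_h_eq_floor]⟩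
    · obtain ⟨a₀, b₀, h₀⟩ := ih n (by omega)
      obtain ⟨a₁, b₁, h₁⟩ := ih (n + 1) (by omega)
      rcases hs : (GenContFract.of v).s.get? n with _ | gp
      · exact ⟨a₁, b₁, by
          rw [contsAux_stable_step_of_terminated (n := n) hs, h₁]⟩
      · obtain ⟨ha, k, hk⟩ := of_partNum_eq_one_and_exists_int_partDen_eq hs
        refine ⟨k * a₁ + a₀, k * b₁ + b₀, ?_⟩
        rw [contsAux_recurrence hs h₀ h₁, ha, hk]
        push_cast
        simp

theorem GenContFract.one_le_of_den {v : ℝ} (hv : Irrational v) (n : ℕ) :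
    1 ≤ (GenContFract.of v).dens n := by
  have hterm : ¬ (GenContFract.of v).TerminatedAt (n - 1) := fun h => by
    obtain ⟨q, hq⟩ := GenContFract.exists_rat_eq_of_terminates ⟨n - 1, h⟩
    exact hv ⟨q, hq.symm⟩
  refine le_trans ?_ (GenContFract.succ_nth_fib_le_of_nth_den (v := v) (n := n) (Or.inr hterm))
  exact_mod_cast Nat.fib_pos.2 n.succ_pos

/-- Convergents of even index lie below an irrational number. -/
theorem GenContFract.sub_convs_even_mem_Ioc {v : ℝ} (hv : Irrational v) (n : ℕ) :
    v - (GenContFract.of v).convs (2 * n) ∈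
      Set.Ioc 0 (1 / (GenContFract.of v).dens (2 * n) ^ 2) := by
  have hterm : ¬ (GenContFract.of v).TerminatedAt (2 * n) := fun h => by
    obtain ⟨q, hq⟩ := GenContFract.exists_rat_eq_of_terminates ⟨2 * n, h⟩
    exact hv ⟨q, hq.symm⟩
  obtain ⟨gp, hgp⟩ := Option.ne_none_iff_exists'.1 hterm
  obtain ⟨ifp', hifp', -⟩ :=
    GenContFract.IntFractPair.exists_succ_get?_stream_of_gcf_of_get?_eq_some hgp
  obtain ⟨ifp, hifp, hfr, -⟩ :=
    GenContFract.IntFractPair.succ_nth_stream_eq_some_iff.1 hifp'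
  have hlt := GenContFract.IntFractPair.nth_stream_fr_lt_one hifp
  have hpos := (GenContFract.IntFractPair.nth_stream_fr_nonneg hifp).lt_of_ne' hfr
  have h := GenContFract.sub_convs_eq hifp
  have hB := GenContFract.one_le_of_den hv (2 * n)
  have hpB := GenContFract.zero_le_of_contsAux_b (v := v) (n := 2 * n)
  simp only [hfr, if_false, Even.neg_one_pow (even_two_mul n)] at h
  rw [← GenContFract.nth_cont_eq_succ_nth_contAux, ← GenContFract.den_eq_conts_b] at h
  have hinv : 1 ≤ ifp.fr⁻¹ := (one_le_inv₀ hpos).2 hlt.le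
  set B := (GenContFract.of v).dens (2 * n)
  rw [h]
  have : B ^ 2 ≤ B * (ifp.fr⁻¹ * B + ((GenContFract.of v).contsAux (2 * n)).b) := by
    nlinarith [mul_le_mul_of_nonneg_right hinv (by positivity : 0 ≤ B * B),
      mul_nonneg (zero_le_one.trans hB) hpB]
  have hB2 : 0 < B ^ 2 := by positivity
  exact ⟨one_div_pos.2 (hB2.trans_le this), one_div_le_one_div_of_le hB2 this⟩

theorem GenContFract.div_sq_dens_le_abs_sub_convs {v C : ℝ} (hv : Irrational v)
    (hC : ∀ q : ℕ, 0 < q → C / (q : ℝ) ≤ |(q : ℝ) * v - round ((q : ℝ) * v)|) (n : ℕ) :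
    C / (GenContFract.of v).dens n ^ 2 ≤ |v - (GenContFract.of v).convs n| := by
  obtain ⟨a, b, hab⟩ := GenContFract.exists_int_contsAux_of v (n + 1)
  have hB := GenContFract.one_le_of_den hv n
  rw [GenContFract.conv_eq_num_div_den, GenContFract.num_eq_conts_a]
  rw [GenContFract.den_eq_conts_b, GenContFract.nth_cont_eq_succ_nth_contAux, hab] at hB ⊢
  dsimp only at hB ⊢
  have hb : (0 : ℝ) < b := zero_lt_one.trans_le hB
  lift b to ℕ using by exact_mod_cast hb.le
  rw [Int.cast_natCast] at hb ⊢
  have h := (hC b (by exact_mod_cast hb)).trans (round_le ((b : ℝ) * v) a)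
  have heq : v - a / b = (b * v - a) / b := by field_simp
  rw [heq, abs_div, abs_of_pos hb, pow_two, ← div_div]
  gcongr

/-- Two-sided bound for `d / e` when `e` is comparable to `1 / q ^ 2`. -/
theorem div_mem_Icc_of_mem_Icc {C d e q : ℝ} (hC : 0 < C) (hd : 0 ≤ d) (hq : 1 ≤ q)
    (hlow : C / q ^ 2 ≤ e) (hupp : e ≤ 1 / q ^ 2) :
    d / e ∈ Set.Icc (d * q ^ 2) (d * q ^ 2 / C) := by
  have hq2 : 0 < q ^ 2 := by positivity
  have he : 0 < e := (div_pos hC hq2).trans_le hlow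
  rw [div_le_iff₀ hq2] at hlow
  rw [le_div_iff₀ hq2] at hupp
  constructor
  · rw [le_div_iff₀ he]
    nlinarith
  · rw [div_le_div_iff₀ he hC]
    nlinarith

/-- Bounds for the second elementary symmetric function `x * t + x * t' + t * t'` when `t` and `t'`
are comparable to `d * q ^ 2` and `d' * r ^ 2`. -/
theorem secondSymm_bounds {ε C N x d d' q r t t' : ℝ} (hC : 0 < C)
    (hN : 1 ≤ N) (hx : 1 ≤ x) (hxN : x ≤ N) (hd : 0 ≤ d) (hd' : 0 ≤ d')
    (hdN : d ≤ (Real.sqrt N)⁻¹) (hdN' : d' ≤ (Real.sqrt N)⁻¹) (hprod : ε ≤ x * d * d')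
    (ht : d * q ^ 2 ≤ t) (ht_le : t ≤ d * q ^ 2 / C)
    (ht' : d' * r ^ 2 ≤ t') (ht_le' : t' ≤ d' * r ^ 2 / C) :
    ε * (q ^ 2 * r ^ 2 / N + q ^ 2 + r ^ 2) ≤ x * t + x * t' + t * t' ∧
      x * t + x * t' + t * t' ≤
        (1 / C + 1 / C ^ 2) * (q ^ 2 * r ^ 2 / N + Real.sqrt N * (q ^ 2 + r ^ 2)) := by
  have hN0 : 0 < N := by linarith
  have hx0 : 0 < x := by linarith
  have hs : 1 ≤ Real.sqrt N := Real.one_le_sqrt.2 hN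
  have hss : Real.sqrt N * Real.sqrt N = N := Real.mul_self_sqrt hN0.le
  have hsinv : (Real.sqrt N)⁻¹ ≤ 1 := inv_le_one_of_one_le₀ hs
  have ht0 : 0 ≤ t := le_trans (by positivity) ht
  have ht0' : 0 ≤ t' := le_trans (by positivity) ht'
  constructor
  · have h₁ : ε * q ^ 2 ≤ x * t := calc
      ε * q ^ 2 ≤ x * d * q ^ 2 := by
        gcongr
        exact hprod.trans (mul_le_of_le_one_right (by positivity) (hdN'.trans hsinv))
      _ = x * (d * q ^ 2) := by ring
      _ ≤ x * t := by gcongr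
    have h₂ : ε * r ^ 2 ≤ x * t' := calc
      ε * r ^ 2 ≤ x * d' * r ^ 2 := by
        gcongr
        refine hprod.trans ?_
        rw [mul_right_comm]
        exact mul_le_of_le_one_right (by positivity) (hdN.trans hsinv)
      _ = x * (d' * r ^ 2) := by ring
      _ ≤ x * t' := by gcongr
    have h₃ : ε * (q ^ 2 * r ^ 2 / N) ≤ t * t' := calc
      ε * (q ^ 2 * r ^ 2 / N) ≤ N * d * d' * (q ^ 2 * r ^ 2 / N) := by
        gcongr
        exact hprod.trans (by gcongr)
      _ = (d * q ^ 2) * (d' * r ^ 2) := by field_simp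
      _ ≤ t * t' := by gcongr
    linarith
  · have hNs : N * (Real.sqrt N)⁻¹ = Real.sqrt N := by
      rw [← div_eq_mul_inv, Real.div_sqrt]
    have h₁ : x * t ≤ 1 / C * (Real.sqrt N * q ^ 2) := calc
      x * t ≤ N * ((Real.sqrt N)⁻¹ * q ^ 2 / C) := by
        gcongr
        exact ht_le.trans (by gcongr)
      _ = 1 / C * (N * (Real.sqrt N)⁻¹ * q ^ 2) := by ring
      _ = _ := by rw [hNs]
    have h₂ : x * t' ≤ 1 / C * (Real.sqrt N * r ^ 2) := calc
      x * t' ≤ N * ((Real.sqrt N)⁻¹ * r ^ 2 / C) := by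
        gcongr
        exact ht_le'.trans (by gcongr)
      _ = 1 / C * (N * (Real.sqrt N)⁻¹ * r ^ 2) := by ring
      _ = _ := by rw [hNs]
    have h₃ : t * t' ≤ 1 / C ^ 2 * (q ^ 2 * r ^ 2 / N) := calc
      t * t' ≤ ((Real.sqrt N)⁻¹ * q ^ 2 / C) * ((Real.sqrt N)⁻¹ * r ^ 2 / C) := by
        gcongr
        · exact ht_le.trans (by gcongr)
        · exact ht_le'.trans (by gcongr)
      _ = 1 / C ^ 2 * (q ^ 2 * r ^ 2 / (Real.sqrt N * Real.sqrt N)) := by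
        field_simp
      _ = _ := by rw [hss]
    have h₄ : 0 ≤ 1 / C * (q ^ 2 * r ^ 2 / N) := by positivity
    have h₅ : 0 ≤ 1 / C ^ 2 * (Real.sqrt N * (q ^ 2 + r ^ 2)) := by positivity
    linarith


/-- Estimate for the second elementary symmetric function
`Σ₂ = x·t(α) + x·t(β) + t(α)·t(β)` (with `t(γ) = δ_γ/e_{2n}(γ)`) of the roots of the
auxiliary cubic:
`c₁·(q_{2n}(α)²q_{2n}(β)²/N + q_{2n}(α)² + q_{2n}(β)²) ≤ Σ₂ ≤
 c₂·(q_{2n}(α)²q_{2n}(β)²/N + √N·(q_{2n}(α)² + q_{2n}(β)²))`,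
with constants depending only on `ε` and the bad-approximability constant `C`. -/
theorem sigma2_estimate (ε C : ℝ) (hε : 0 < ε) (hC : 0 < C) :
    ∃ c₁ c₂ : ℝ, 0 < c₁ ∧ 0 < c₂ ∧
      ∀ α β : ℝ, Irrational α → Irrational β →
        (∀ q : ℕ, 0 < q → C / (q : ℝ) ≤ |(q : ℝ) * α - round ((q : ℝ) * α)|) →
        (∀ q : ℕ, 0 < q → C / (q : ℝ) ≤ |(q : ℝ) * β - round ((q : ℝ) * β)|) →
        ∀ N : ℕ, 0 < N → ∀ x y z : ℤ,
          1 ≤ x → (x : ℝ) ≤ N →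
          |α * x - y| ≤ (N : ℝ) ^ (-(1 : ℝ) / 2) →
          |β * x - z| ≤ (N : ℝ) ^ (-(1 : ℝ) / 2) →
          ε ≤ (x : ℝ) * |α * x - y| * |β * x - z| →
          ∀ n : ℕ,
            c₁ * ((GenContFract.of α).dens (2 * n) ^ 2 *
                  (GenContFract.of β).dens (2 * n) ^ 2 / N +
                (GenContFract.of α).dens (2 * n) ^ 2 +
                (GenContFract.of β).dens (2 * n) ^ 2) ≤
              (x : ℝ) * (|α * x - y| / (α - (GenContFract.of α).convs (2 * n))) +
                (x : ℝ) * (|β * x - z| / (β - (GenContFract.of β).convs (2 * n))) +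
                (|α * x - y| / (α - (GenContFract.of α).convs (2 * n))) *
                  (|β * x - z| / (β - (GenContFract.of β).convs (2 * n))) ∧
            (x : ℝ) * (|α * x - y| / (α - (GenContFract.of α).convs (2 * n))) +
                (x : ℝ) * (|β * x - z| / (β - (GenContFract.of β).convs (2 * n))) +
                (|α * x - y| / (α - (GenContFract.of α).convs (2 * n))) *
                  (|β * x - z| / (β - (GenContFract.of β).convs (2 * n))) ≤
              c₂ * ((GenContFract.of α).dens (2 * n) ^ 2 *
                  (GenContFract.of β).dens (2 * n) ^ 2 / N +
                Real.sqrt N * ((GenContFract.of α).dens (2 * n) ^ 2 +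
                  (GenContFract.of β).dens (2 * n) ^ 2)) := by
  refine ⟨ε, 1 / C + 1 / C ^ 2, hε, by positivity, ?_⟩
  intro α β hα hβ hCα hCβ N hN x y z hx hxN hdα hdβ hprod n
  have hqα := GenContFract.one_le_of_den hα (2 * n)
  have hqβ := GenContFract.one_le_of_den hβ (2 * n)
  obtain ⟨heα, heα'⟩ := GenContFract.sub_convs_even_mem_Ioc hα n
  obtain ⟨heβ, heβ'⟩ := GenContFract.sub_convs_even_mem_Ioc hβ n
  have hlα := GenContFract.div_sq_dens_le_abs_sub_convs hα hCα (2 * n)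
  have hlβ := GenContFract.div_sq_dens_le_abs_sub_convs hβ hCβ (2 * n)
  rw [abs_of_pos heα] at hlα
  rw [abs_of_pos heβ] at hlβ
  obtain ⟨htα, htα'⟩ := div_mem_Icc_of_mem_Icc hC (abs_nonneg (α * x - y)) hqα hlα heα'
  obtain ⟨htβ, htβ'⟩ := div_mem_Icc_of_mem_Icc hC (abs_nonneg (β * x - z)) hqβ hlβ heβ'
  have hN1 : (1 : ℝ) ≤ N := by exact_mod_cast hN
  have hx1 : (1 : ℝ) ≤ x := by exact_mod_cast hx
  have hpow : (N : ℝ) ^ (-(1 : ℝ) / 2) = (Real.sqrt N)⁻¹ := by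
    rw [neg_div, Real.rpow_neg (by positivity), Real.sqrt_eq_rpow]
  rw [hpow] at hdα hdβ
  have hd0α := abs_nonneg (α * x - y)
  have hd0β := abs_nonneg (β * x - z)
  generalize |α * x - y| = d at *
  generalize |β * x - z| = d' at *
  generalize d / (α - (GenContFract.of α).convs (2 * n)) = t at *
  generalize d' / (β - (GenContFract.of β).convs (2 * n)) = t' at *
  generalize (GenContFract.of α).dens (2 * n) = q at *
  generalize (GenContFract.of β).dens (2 * n) = r at *
  generalize (x : ℝ) = X at *
  exact secondSymm_bounds hC hN1 hx1 hxN hd0α hd0β hdα hdβ hprod htα htα' htβ htβ'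
end

section
/- Let P < 0 be a real number and let C₁, C₂ ∈ [−1, 1]. Then | 2√(−P/3)·cos( (1/3)·arccos(C₁) ) − 2√(−P/3)·cos( (1/3)·arccos(C₂) ) | ≥ (1/(36√3)) · √(−P) · (C₁ − C₂)². -/
/-- The cosine of a third of an inverse cosine is a root of `4 x ^ 3 - 3 x = C` in `[1/2, 1]`. -/
theorem cos_third_arccos {C : ℝ} (hC : C ∈ Set.Icc (-1 : ℝ) 1) :
    4 * Real.cos ((1 / 3) * Real.arccos C) ^ 3 - 3 * Real.cos ((1 / 3) * Real.arccos C) = C ∧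
      1 / 2 ≤ Real.cos ((1 / 3) * Real.arccos C) ∧ Real.cos ((1 / 3) * Real.arccos C) ≤ 1 := by
  refine ⟨?_, ?_, Real.cos_le_one _⟩
  · rw [← Real.cos_three_mul, ← mul_assoc, mul_one_div_cancel three_ne_zero, one_mul,
      Real.cos_arccos hC.1 hC.2]
  · rw [← Real.cos_pi_div_three]
    apply Real.cos_le_cos_of_nonneg_of_le_pi
    · linarith [Real.arccos_nonneg C]
    · linarith [Real.pi_pos]
    · linarith [Real.arccos_le_pi C]

/-- The squared gap between two values in `[-1, 1]` of `4 x ^ 3 - 3 x` on `[1/2, 1]` is controlled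
by the gap between the arguments. -/
theorem sq_sub_le_abs_cos_third_arccos_sub {C₁ C₂ : ℝ} (h₁ : C₁ ∈ Set.Icc (-1 : ℝ) 1)
    (h₂ : C₂ ∈ Set.Icc (-1 : ℝ) 1) :
    (C₁ - C₂) ^ 2 ≤
      18 * |Real.cos ((1 / 3) * Real.arccos C₁) - Real.cos ((1 / 3) * Real.arccos C₂)| := by
  obtain ⟨e₁, l₁, u₁⟩ := cos_third_arccos h₁
  obtain ⟨e₂, l₂, u₂⟩ := cos_third_arccos h₂
  set x := Real.cos ((1 / 3) * Real.arccos C₁)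
  set y := Real.cos ((1 / 3) * Real.arccos C₂)
  have hfac : C₁ - C₂ = (x - y) * (4 * (x ^ 2 + x * y + y ^ 2) - 3) := by
    rw [← e₁, ← e₂]; ring
  have hle : |4 * (x ^ 2 + x * y + y ^ 2) - 3| ≤ 9 := by
    rw [abs_le]; constructor <;> nlinarith
  have hC : |C₁ - C₂| ≤ 2 := by
    rw [abs_le]; constructor <;> linarith [h₁.1, h₁.2, h₂.1, h₂.2]
  have hlip : |C₁ - C₂| ≤ |x - y| * 9 := by
    rw [hfac, abs_mul]; gcongr
  rw [← sq_abs]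
  nlinarith [abs_nonneg (C₁ - C₂)]

/-- For `P < 0` and `C₁, C₂ ∈ [-1, 1]`, the difference between the trigonometric root
expressions `2√(-P/3)·cos((1/3)·arccos Cᵢ)` is at least `(1/(36√3))·√(-P)·(C₁ - C₂)²`
in absolute value. -/
theorem trig_roots_gap (P : ℝ) (hP : P < 0) (C₁ C₂ : ℝ)
    (h₁ : C₁ ∈ Set.Icc (-1 : ℝ) 1) (h₂ : C₂ ∈ Set.Icc (-1 : ℝ) 1) :
    |2 * Real.sqrt (-P / 3) * Real.cos ((1 / 3) * Real.arccos C₁) -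
        2 * Real.sqrt (-P / 3) * Real.cos ((1 / 3) * Real.arccos C₂)| ≥
      (1 / (36 * Real.sqrt 3)) * Real.sqrt (-P) * (C₁ - C₂) ^ 2 := by
  rw [← mul_sub, abs_mul, abs_of_nonneg (by positivity : 0 ≤ 2 * Real.sqrt (-P / 3)),
    Real.sqrt_div (by linarith : 0 ≤ -P), ge_iff_le]
  have key := sq_sub_le_abs_cos_third_arccos_sub h₁ h₂
  set d := |Real.cos ((1 / 3) * Real.arccos C₁) - Real.cos ((1 / 3) * Real.arccos C₂)|
  have hd : 0 ≤ d := abs_nonneg _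
  calc (1 / (36 * Real.sqrt 3)) * Real.sqrt (-P) * (C₁ - C₂) ^ 2
      ≤ (1 / (36 * Real.sqrt 3)) * Real.sqrt (-P) * (72 * d) := by
        gcongr; linarith
    _ = 2 * (Real.sqrt (-P) / Real.sqrt 3) * d := by
        field_simp; ring
end

section
/- Let A > 0 and Σ₁, Σ₂, Σ₃ be real numbers such that P := Σ₂ − Σ₁²/3 < 0, and let ε > 0. For s ∈ {ε, −ε} define Q(s) := (2Σ₁³ − 9Σ₁Σ₂)/27 + Σ₃ + s/A and C(s) := (Q(s)/2)·(3/(−P))^{3/2}, and assume |C(ε)| ≤ 1 and |C(−ε)| ≤ 1. Define t(s) := 2√(−P/3)·cos( (1/3)·arccos(C(s)) ) + Σ₁/3. Then | t(ε) − t(−ε) | ≥ (√3/4) · ε² / ( (−P)^{5/2} · A² ). -/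
/-- The cosine of a third of `arccos c` is the root in `[1/2, 1]` of the cubic `4x³ - 3x = c`. -/
theorem Real.cos_third_arccos_spec {c : ℝ} (hc : |c| ≤ 1) :
    1 / 2 ≤ Real.cos ((1 / 3) * Real.arccos c) ∧ Real.cos ((1 / 3) * Real.arccos c) ≤ 1 ∧
      4 * Real.cos ((1 / 3) * Real.arccos c) ^ 3 - 3 * Real.cos ((1 / 3) * Real.arccos c) = c := by
  have h0 := Real.arccos_nonneg c
  have h1 := Real.arccos_le_pi c
  obtain ⟨hc1, hc2⟩ := abs_le.mp hc
  refine ⟨?_, Real.cos_le_one _, ?_⟩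
  · rw [← Real.cos_pi_div_three]
    exact Real.cos_le_cos_of_nonneg_of_le_pi (by positivity) (by linarith [Real.pi_pos])
      (by linarith)
  · rw [← Real.cos_three_mul, show 3 * (1 / 3 * Real.arccos c) = Real.arccos c by ring,
      Real.cos_arccos hc1 hc2]

/-- The inverse of `x ↦ 4x³ - 3x` on `[1/2, 1]` expands distances by a factor at least `1/9`. -/
theorem Real.sub_div_nine_le_cos_third_arccos_sub {c d : ℝ} (hc : |c| ≤ 1) (hd : |d| ≤ 1)
    (hdc : d < c) :
    (c - d) / 9 ≤ Real.cos ((1 / 3) * Real.arccos c) - Real.cos ((1 / 3) * Real.arccos d) := by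
  obtain ⟨hx0, hx1, hx⟩ := Real.cos_third_arccos_spec hc
  obtain ⟨hy0, hy1, hy⟩ := Real.cos_third_arccos_spec hd
  set x := Real.cos ((1 / 3) * Real.arccos c)
  set y := Real.cos ((1 / 3) * Real.arccos d)
  have hK0 : 0 ≤ 4 * (x ^ 2 + x * y + y ^ 2) - 3 := by nlinarith
  have hK9 : 4 * (x ^ 2 + x * y + y ^ 2) - 3 ≤ 9 := by nlinarith
  have hfac : (x - y) * (4 * (x ^ 2 + x * y + y ^ 2) - 3) = c - d := by
    rw [← hx, ← hy]; ring
  have hxy : 0 < x - y := pos_of_mul_pos_left (by rw [hfac]; linarith) hK0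
  nlinarith [mul_le_mul_of_nonneg_left hK9 hxy.le]


/-- Gap between the trigonometric roots of the two perturbed cubics
`t³ - Σ₁t² + Σ₂t - (Σ₃ ± ε/A) = 0`: with `P := Σ₂ - Σ₁²/3 < 0`,
`Q(s) := (2Σ₁³ - 9Σ₁Σ₂)/27 + Σ₃ + s/A`, `C(s) := (Q(s)/2)·(3/(-P))^{3/2}`, and
`t(s) := 2√(-P/3)·cos((1/3)·arccos(C(s))) + Σ₁/3`, if `|C(ε)| ≤ 1` and `|C(-ε)| ≤ 1`
then `|t(ε) - t(-ε)| ≥ (√3/4)·ε²/((-P)^{5/2}·A²)`.  Here `S1, S2, S3` denote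
`Σ₁, Σ₂, Σ₃`. -/
theorem perturbed_cubic_root_gap (A S1 S2 S3 ε : ℝ) (hA : 0 < A) (hε : 0 < ε)
    (P : ℝ) (hP : P = S2 - S1 ^ 2 / 3) (hPneg : P < 0)
    (Qp Qm Cp Cm tp tm : ℝ)
    (hQp : Qp = (2 * S1 ^ 3 - 9 * S1 * S2) / 27 + S3 + ε / A)
    (hQm : Qm = (2 * S1 ^ 3 - 9 * S1 * S2) / 27 + S3 + (-ε) / A)
    (hCp : Cp = (Qp / 2) * (3 / (-P)) ^ ((3 : ℝ) / 2))
    (hCm : Cm = (Qm / 2) * (3 / (-P)) ^ ((3 : ℝ) / 2))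
    (hCp1 : |Cp| ≤ 1) (hCm1 : |Cm| ≤ 1)
    (htp : tp = 2 * Real.sqrt (-P / 3) * Real.cos ((1 / 3) * Real.arccos Cp) + S1 / 3)
    (htm : tm = 2 * Real.sqrt (-P / 3) * Real.cos ((1 / 3) * Real.arccos Cm) + S1 / 3) :
    |tp - tm| ≥ (Real.sqrt 3 / 4) * ε ^ 2 / ((-P) ^ ((5 : ℝ) / 2) * A ^ 2) := by
  obtain ⟨r, hr, hrP⟩ : ∃ r : ℝ, 0 < r ∧ -P = r ^ 2 :=
    ⟨√(-P), Real.sqrt_pos.mpr (by linarith), (Real.sq_sqrt (by linarith)).symm⟩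
  have h3 : (0 : ℝ) < √3 := by positivity
  have h33 : √3 ^ 2 = 3 := Real.sq_sqrt (by norm_num)
  have hpow5 : (-P) ^ ((5 : ℝ) / 2) = r ^ 5 := by
    rw [hrP, ← Real.rpow_natCast r 2, ← Real.rpow_mul hr.le, ← Real.rpow_natCast r 5]
    norm_num
  have hpow3 : (3 / (-P)) ^ ((3 : ℝ) / 2) = (√3 / r) ^ 3 := by
    rw [show 3 / (-P) = (√3 / r) ^ 2 by rw [div_pow, h33, hrP],
      ← Real.rpow_natCast (√3 / r) 2, ← Real.rpow_mul (by positivity),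
      ← Real.rpow_natCast (√3 / r) 3]
    norm_num
  have hsqrt : √(-P / 3) = r / √3 := by
    rw [hrP, Real.sqrt_div (by positivity), Real.sqrt_sq hr.le]
  obtain ⟨δ, hδ⟩ : ∃ δ, δ = ε / A := ⟨_, rfl⟩
  have hδ0 : 0 < δ := hδ ▸ div_pos hε hA
  have hdiff : Cp - Cm = δ * (√3 / r) ^ 3 := by
    rw [hCp, hCm, hpow3, hQp, hQm, hδ]; ring
  have hdiff0 : 0 < δ * (√3 / r) ^ 3 := by positivity
  have hroot := Real.sub_div_nine_le_cos_third_arccos_sub hCp1 hCm1 (by linarith)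
  have hgap : (2 / 3) * (δ / r ^ 2) ≤ tp - tm := by
    calc (2 / 3) * (δ / r ^ 2) = 2 * (r / √3) * ((Cp - Cm) / 9) := by
          rw [hdiff]; field_simp; rw [h33]; norm_num
      _ ≤ 2 * (r / √3) * (Real.cos ((1 / 3) * Real.arccos Cp) -
            Real.cos ((1 / 3) * Real.arccos Cm)) :=
          mul_le_mul_of_nonneg_left hroot (by positivity)
      _ = tp - tm := by rw [htp, htm, hsqrt]; ring
  have hδle : √3 * (δ / r ^ 3) ≤ 2 / 3 := by
    have h2 : δ * (√3 / r) ^ 3 = 3 * (√3 * (δ / r ^ 3)) := by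
      rw [div_pow, pow_succ, h33]; ring
    linarith [(abs_le.mp hCp1).2, (abs_le.mp hCm1).1]
  have hrhs : √3 / 4 * ε ^ 2 / ((-P) ^ ((5 : ℝ) / 2) * A ^ 2) =
      (√3 * (δ / r ^ 3)) / 4 * (δ / r ^ 2) := by
    rw [hpow5, hδ]; field_simp
  rw [ge_iff_le, hrhs]
  calc (√3 * (δ / r ^ 3)) / 4 * (δ / r ^ 2) ≤ (2 / 3) * (δ / r ^ 2) :=
        mul_le_mul_of_nonneg_right (by linarith) (by positivity)
    _ ≤ tp - tm := hgap
    _ ≤ |tp - tm| := le_abs_self _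
end
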